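/- arXiv:1506.08883 — 2 statements merged into one kernel-verified Lean document; each statement's English description precedes it below -/
import Mathlib

section
/- For every qudit dimension d there exists a constant c < 1 (the constant from the tripartite entanglement-decrease proposition with d_A = d_C = d) such that the following holds. Let Ψ be a non-negative pure state on a line of L qudits of dimension d with zero correlation length. Then for any 1 ≤ i < j ≤ L, the expected entanglement entropy between the region {1,…,i} and the region {j,…,L} after measuring the sites i+1,…,j−1 in the computational basis satisfies Σ_σ P(σ) · S(ρ_{1..i}(σ)) ≤ c^{j−i−1} · log d, where the sum runs over outcome strings σ ∈ (Fin d)^{j−i−1} on sites i+1,…,j−1 with P(σ) > 0, P(σ) is the probability of outcome σ, and ρ_{1..i}(σ) is the reduced density matrix on sites 1,…,i of the post-measurement pure state. -/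
open scoped BigOperators
open scoped Classical

/-- Combine a configuration on the sites in `R` with one on the complement. -/
def glue {L d : ℕ} (R : Finset (Fin L)) (τ : {x : Fin L // x ∈ R} → Fin d)
    (μ : {x : Fin L // x ∉ R} → Fin d) : Fin L → Fin d :=
  fun i => if h : i ∈ R then τ ⟨i, h⟩ else μ ⟨i, h⟩

/-- Reduced density matrix of `Ψ` on the set of sites `R`. -/
noncomputable def rhoR {L d : ℕ} (Ψ : (Fin L → Fin d) → ℂ) (R : Finset (Fin L)) :
    Matrix ({x : Fin L // x ∈ R} → Fin d) ({x : Fin L // x ∈ R} → Fin d) ℂ :=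
  Matrix.of fun τ τ' => ∑ μ : {x : Fin L // x ∉ R} → Fin d,
    Ψ (glue R τ μ) * (starRingEnd ℂ) (Ψ (glue R τ' μ))

def NormalizedLine {L d : ℕ} (Ψ : (Fin L → Fin d) → ℂ) : Prop :=
  ∑ σ : Fin L → Fin d, Complex.normSq (Ψ σ) = 1

def NonNegLine {L d : ℕ} (Ψ : (Fin L → Fin d) → ℂ) : Prop :=
  ∀ σ, 0 ≤ (Ψ σ).re ∧ (Ψ σ).im = 0

/-- Zero correlation length: for any two subsets separated by at least one site, the
reduced density matrix on the union factorizes as the (Kronecker) product of the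
reduced density matrices on the pieces. -/
def ZeroCorr {L d : ℕ} (Ψ : (Fin L → Fin d) → ℂ) : Prop :=
  ∀ A B : Finset (Fin L),
    (∀ a ∈ A, ∀ b ∈ B, 2 ≤ |(a : ℤ) - (b : ℤ)|) →
    ∀ τ τ' : {x : Fin L // x ∈ A ∪ B} → Fin d,
      rhoR Ψ (A ∪ B) τ τ' =
        rhoR Ψ A (fun a => τ ⟨a.1, Finset.mem_union_left B a.2⟩)
          (fun a => τ' ⟨a.1, Finset.mem_union_left B a.2⟩) *
        rhoR Ψ B (fun b => τ ⟨b.1, Finset.mem_union_right A b.2⟩)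
          (fun b => τ' ⟨b.1, Finset.mem_union_right A b.2⟩)

/-- Probability of outcome `σ` when measuring the sites in `M` in the computational basis. -/
noncomputable def probM {L d : ℕ} (Ψ : (Fin L → Fin d) → ℂ) (M : Finset (Fin L))
    (σ : {x : Fin L // x ∈ M} → Fin d) : ℝ :=
  ∑ y : Fin L → Fin d,
    if ∀ k : {x : Fin L // x ∈ M}, y k.1 = σ k then Complex.normSq (Ψ y) else 0

/-- The (normalized) post-measurement pure state after obtaining outcome `σ` on `M`. -/
noncomputable def postState {L d : ℕ} (Ψ : (Fin L → Fin d) → ℂ) (M : Finset (Fin L))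
    (σ : {x : Fin L // x ∈ M} → Fin d) : (Fin L → Fin d) → ℂ :=
  fun y => if ∀ k : {x : Fin L // x ∈ M}, y k.1 = σ k
    then Ψ y / (Real.sqrt (probM Ψ M σ) : ℂ) else 0

noncomputable def vnEntropy {n : Type*} [Fintype n] [DecidableEq n]
    (ρ : Matrix n n ℂ) : ℝ :=
  if h : ρ.IsHermitian then -∑ a, h.eigenvalues a * Real.log (h.eigenvalues a) else 0

set_option linter.unusedSectionVars false

theorem lagrange_sum {U : Type*} (s : Finset U) (f g : U → ℝ) :
    ∑ u ∈ s, ∑ v ∈ s, (f u * g v - f v * g u) ^ 2 =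
      2 * ((∑ u ∈ s, f u ^ 2) * (∑ u ∈ s, g u ^ 2) - (∑ u ∈ s, f u * g u) ^ 2) := by
  have e : ∀ u v, (f u * g v - f v * g u) ^ 2 =
      f u ^ 2 * g v ^ 2 + g u ^ 2 * f v ^ 2 - 2 * ((f u * g u) * (f v * g v)) := by
    intros; ring
  simp only [e, Finset.sum_add_distrib, Finset.sum_sub_distrib, ← Finset.mul_sum,
    ← Finset.sum_mul]
  ring

/-- Squared Frobenius norm of a real matrix. -/
def frobSq {A C : Type*} [Fintype A] [Fintype C] (M : A → C → ℝ) : ℝ :=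
  ∑ a, ∑ c, M a c ^ 2

/-- The trace of the square of `M Mᵀ`. -/
def gramSq {A C : Type*} [Fintype A] [Fintype C] (M : A → C → ℝ) : ℝ :=
  ∑ a, ∑ a', (∑ c, M a c * M a' c) ^ 2

/-- The unnormalised linear entropy of the bipartite state `M`, weighted by its norm. -/
noncomputable def linEnt {A C : Type*} [Fintype A] [Fintype C] (M : A → C → ℝ) : ℝ :=
  frobSq M - gramSq M / frobSq M

section tripartite

variable {A B C : Type*} [Fintype A] [Fintype B] [Fintype C]

theorem gramSq_swap (M : A → C → ℝ) : gramSq (fun c a => M a c) = gramSq M := by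
  unfold gramSq
  simp only [pow_two, Finset.sum_mul_sum]
  rw [Finset.sum_comm' (t' := Finset.univ) (s' := fun _ => Finset.univ) (by simp)]
  calc _ = ∑ c', ∑ c, ∑ a, ∑ a', M a c * M a c' * (M a' c * M a' c') := rfl
    _ = ∑ c', ∑ a, ∑ c, ∑ a', M a c * M a c' * (M a' c * M a' c') := by
        refine Finset.sum_congr rfl fun _ _ => Finset.sum_comm
    _ = ∑ a, ∑ c', ∑ c, ∑ a', M a c * M a c' * (M a' c * M a' c') := Finset.sum_comm
    _ = ∑ a, ∑ c', ∑ a', ∑ c, M a c * M a c' * (M a' c * M a' c') := by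
        refine Finset.sum_congr rfl fun _ _ => Finset.sum_congr rfl fun _ _ => Finset.sum_comm
    _ = ∑ a, ∑ a', ∑ c', ∑ c, M a c * M a c' * (M a' c * M a' c') := by
        refine Finset.sum_congr rfl fun _ _ => Finset.sum_comm
    _ = _ := by
        refine Finset.sum_congr rfl fun _ _ => Finset.sum_congr rfl fun _ _ =>
          Finset.sum_congr rfl fun _ _ => Finset.sum_congr rfl fun _ _ => ?_
        ring

theorem frobSq_swap (M : A → C → ℝ) : frobSq (fun c a => M a c) = frobSq M :=
  Finset.sum_comm

theorem frobSq_nonneg (M : A → C → ℝ) : 0 ≤ frobSq M :=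
  Finset.sum_nonneg fun _ _ => Finset.sum_nonneg fun _ _ => sq_nonneg _

theorem gramSq_nonneg (M : A → C → ℝ) : 0 ≤ gramSq M :=
  Finset.sum_nonneg fun _ _ => Finset.sum_nonneg fun _ _ => sq_nonneg _

theorem gramSq_le (M : A → C → ℝ) : gramSq M ≤ frobSq M ^ 2 := by
  unfold gramSq frobSq
  rw [pow_two, Finset.sum_mul_sum]
  refine Finset.sum_le_sum fun a _ => Finset.sum_le_sum fun a' _ => ?_
  exact Finset.sum_mul_sq_le_sq_mul_sq _ _ _

theorem linEnt_swap (M : A → C → ℝ) : linEnt (fun c a => M a c) = linEnt M := by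
  unfold linEnt; rw [gramSq_swap, frobSq_swap]

theorem linEnt_nonneg (M : A → C → ℝ) : 0 ≤ linEnt M := by
  unfold linEnt
  rcases (frobSq_nonneg M).eq_or_lt with h | h
  · simp [← h]
  · rw [sub_nonneg, div_le_iff₀ h, ← pow_two]; exact gramSq_le M

theorem linEnt_le_sqrt (M : A → C → ℝ) : linEnt M ≤ √(frobSq M ^ 2 - gramSq M) := by
  unfold linEnt
  rcases (frobSq_nonneg M).eq_or_lt with h | h
  · simp [← h]
  · apply Real.le_sqrt_of_sq_le
    have h1 := gramSq_le M
    have h2 := gramSq_nonneg M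
    have e : frobSq M - gramSq M / frobSq M = (frobSq M ^ 2 - gramSq M) / frobSq M := by
      field_simp
    rw [e, div_pow, div_le_iff₀ (by positivity)]
    nlinarith

theorem linEnt_smul (M : A → C → ℝ) (t : ℝ) :
    linEnt (fun a c => t * M a c) = t ^ 2 * linEnt M := by
  have h1 : frobSq (fun a c => t * M a c) = t ^ 2 * frobSq M := by
    simp only [frobSq, mul_pow, Finset.mul_sum]
  have h2 : gramSq (fun a c => t * M a c) = t ^ 4 * gramSq M := by
    simp only [gramSq, Finset.mul_sum]
    refine Finset.sum_congr rfl fun a _ => Finset.sum_congr rfl fun a' _ => ?_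
    have : ∑ c, t * M a c * (t * M a' c) = t ^ 2 * ∑ c, M a c * M a' c := by
      rw [Finset.mul_sum]; exact Finset.sum_congr rfl fun _ _ => by ring
    rw [this]; ring
  unfold linEnt
  rw [h1, h2]
  by_cases ht : t = 0
  · simp [ht]
  by_cases hf : frobSq M = 0
  · simp [hf]
  field_simp

theorem weighted_sq_le {ι : Type*} (s : Finset ι) (p x : ι → ℝ) (hp : ∀ i ∈ s, 0 ≤ p i)
    (h1 : ∑ i ∈ s, p i = 1) : (∑ i ∈ s, p i * x i) ^ 2 ≤ ∑ i ∈ s, p i * x i ^ 2 :=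
  Real.pow_arith_mean_le_arith_mean_pow_of_even s p x hp h1 even_two
  
variable {M : B → A → C → ℝ} {α : A → A → ℝ} {γ : C → C → ℝ}

theorem tri_swap (h : ∀ a a' c c', ∑ b, M b a c * M b a' c' = α a a' * γ c c') :
    ∀ c c' a a', ∑ b, (fun b c a => M b a c) b c a * (fun b c a => M b a c) b c' a' =
      γ c c' * α a a' := by
  intro c c' a a'; rw [mul_comm]; exact h a a' c c'

theorem tri_left (h : ∀ a a' c c', ∑ b, M b a c * M b a' c' = α a a' * γ c c')
    (hγ : ∑ c, γ c c = 1) (a a' : A) : ∑ b, ∑ c, M b a c * M b a' c = α a a' := by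
  rw [Finset.sum_comm]
  simp only [h, ← Finset.mul_sum, hγ, mul_one]

theorem tri_left_nonneg (hM : ∀ b a c, 0 ≤ M b a c)
    (h : ∀ a a' c c', ∑ b, M b a c * M b a' c' = α a a' * γ c c')
    (hγ : ∑ c, γ c c = 1) (a a' : A) : 0 ≤ α a a' := by
  rw [← tri_left h hγ]
  exact Finset.sum_nonneg fun b _ => Finset.sum_nonneg fun c _ => mul_nonneg (hM _ _ _) (hM _ _ _)

/-- Two rows whose total overlap is small cannot both be populated for the same outcome. -/
theorem sum_rows_le_overlap (hM : ∀ b a c, 0 ≤ M b a c)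
    (h : ∀ a a' c c', ∑ b, M b a c * M b a' c' = α a a' * γ c c')
    (hα : ∑ a, α a a = 1) (hγ : ∑ c, γ c c = 1) (a a' : A) :
    ∑ b, (∑ c, M b a c ^ 2) * (∑ c, M b a' c ^ 2) ≤ √(α a a) * √(α a' a') * α a a' := by
  have hα0 := tri_left_nonneg hM h hγ
  have hγ0 := tri_left_nonneg (fun b c a => hM b a c) (tri_swap h) hα
  have hle : ∀ b a c, M b a c ≤ √(α a a) * √(γ c c) := by
    intro b a c
    rw [← Real.sqrt_mul (hα0 a a)]
    apply Real.le_sqrt_of_sq_le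
    rw [← h, pow_two]
    exact Finset.single_le_sum (f := fun b => M b a c * M b a c)
      (fun i _ => mul_self_nonneg _) (Finset.mem_univ b)
  have hrow : ∀ b a, ∑ c, M b a c ^ 2 ≤ √(α a a) * ∑ c, √(γ c c) * M b a c := by
    intro b a
    rw [Finset.mul_sum]
    refine Finset.sum_le_sum fun c _ => ?_
    nlinarith [mul_le_mul_of_nonneg_right (hle b a c) (hM b a c)]
  have hcs : ∀ c c', γ c c' ≤ √(γ c c) * √(γ c' c') := by
    intro c c'
    rw [← Real.sqrt_mul (hγ0 c c)]
    apply Real.le_sqrt_of_sq_le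
    have hx := tri_left (tri_swap h) hα
    rw [← hx c c', ← hx c c, ← hx c' c', ← Finset.sum_product', ← Finset.sum_product',
      ← Finset.sum_product']
    simp only [← pow_two]
    exact Finset.sum_mul_sq_le_sq_mul_sq _ _ _
  have hκ : ∑ c, ∑ c', √(γ c c) * √(γ c' c') * γ c c' ≤ 1 := by
    calc _ ≤ ∑ c, ∑ c', γ c c * γ c' c' := by
          refine Finset.sum_le_sum fun c _ => Finset.sum_le_sum fun c' _ => ?_
          calc _ ≤ √(γ c c) * √(γ c' c') * (√(γ c c) * √(γ c' c')) :=
                mul_le_mul_of_nonneg_left (hcs c c') (by positivity)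
            _ = (√(γ c c) * √(γ c c)) * (√(γ c' c') * √(γ c' c')) := by ring
            _ = _ := by rw [Real.mul_self_sqrt (hγ0 _ _), Real.mul_self_sqrt (hγ0 _ _)]
      _ = 1 := by rw [← Finset.sum_mul_sum, hγ]; norm_num
  calc _ ≤ ∑ b, (√(α a a) * ∑ c, √(γ c c) * M b a c) *
        (√(α a' a') * ∑ c, √(γ c c) * M b a' c) := by
        refine Finset.sum_le_sum fun b _ => mul_le_mul (hrow b a) (hrow b a')
          (Finset.sum_nonneg fun _ _ => sq_nonneg _) ?_
        exact mul_nonneg (Real.sqrt_nonneg _) (Finset.sum_nonneg fun c _ =>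
          mul_nonneg (Real.sqrt_nonneg _) (hM _ _ _))
    _ = √(α a a) * √(α a' a') * ∑ b, ∑ c, ∑ c', √(γ c c) * √(γ c' c') *
          (M b a c * M b a' c') := by
        rw [Finset.mul_sum]
        refine Finset.sum_congr rfl fun b _ => ?_
        rw [mul_mul_mul_comm, Finset.sum_mul_sum]
        congr 1
        exact Finset.sum_congr rfl fun _ _ => Finset.sum_congr rfl fun _ _ => by ring
    _ = √(α a a) * √(α a' a') * (α a a' * ∑ c, ∑ c', √(γ c c) * √(γ c' c') * γ c c') := by
        congr 1
        rw [Finset.sum_comm, Finset.mul_sum]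
        refine Finset.sum_congr rfl fun c _ => ?_
        rw [Finset.sum_comm, Finset.mul_sum]
        refine Finset.sum_congr rfl fun c' _ => ?_
        rw [← Finset.mul_sum, h]; ring
    _ ≤ _ := by
        refine mul_le_mul_of_nonneg_left ?_ (by positivity)
        exact mul_le_of_le_one_right (hα0 _ _) hκ

/-- Squared areas spanned by blocks of two vectors add up to at most the squared area spanned by
the vectors themselves. -/
theorem sum_area_sq_le (f g : B → C → ℝ) :
    ∑ b, ((∑ c, f b c ^ 2) * (∑ c, g b c ^ 2) - (∑ c, f b c * g b c) ^ 2) ≤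
      (∑ b, ∑ c, f b c ^ 2) * (∑ b, ∑ c, g b c ^ 2) - (∑ b, ∑ c, f b c * g b c) ^ 2 := by
  have h1 := lagrange_sum (Finset.univ : Finset (B × C)) (fun u => f u.1 u.2) (fun u => g u.1 u.2)
  simp only [← Finset.univ_product_univ, Finset.sum_product] at h1
  have h2 : ∀ b, _ := fun b => lagrange_sum (Finset.univ : Finset C) (f b) (g b)
  have h3 : ∑ b, 2 * ((∑ c, f b c ^ 2) * (∑ c, g b c ^ 2) - (∑ c, f b c * g b c) ^ 2) ≤
      ∑ b, ∑ c, ∑ b', ∑ c', (f b c * g b' c' - f b' c' * g b c) ^ 2 := by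
    refine Finset.sum_le_sum fun b _ => ?_
    rw [← h2 b]
    refine Finset.sum_le_sum fun c _ => ?_
    exact Finset.single_le_sum
      (f := fun b' => ∑ c', (f b c * g b' c' - f b' c' * g b c) ^ 2)
      (fun i _ => Finset.sum_nonneg fun _ _ => sq_nonneg _) (Finset.mem_univ b)
  rw [← Finset.mul_sum] at h3
  linarith

theorem sum_frobSq_sub_gramSq_le (hM : ∀ b a c, 0 ≤ M b a c)
    (h : ∀ a a' c c', ∑ b, M b a c * M b a' c' = α a a' * γ c c')
    (hα : ∑ a, α a a = 1) (hγ : ∑ c, γ c c = 1) :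
    ∑ b, (frobSq (M b) ^ 2 - gramSq (M b)) ≤
      3 * (∑ a, ∑ a', √(α a a) * √(α a' a') * α a a' - ∑ a, ∑ a', α a a' ^ 2) := by
  have hα0 := tri_left_nonneg hM h hγ
  have key : ∀ a a', ∑ b, ((∑ c, M b a c ^ 2) * (∑ c, M b a' c ^ 2) -
      (∑ c, M b a c * M b a' c) ^ 2) ≤ 3 * (√(α a a) * √(α a' a') * α a a' - α a a' ^ 2) := by
    intro a a'
    have h1 := sum_rows_le_overlap hM h hα hγ a a'
    have h2 := sum_area_sq_le (fun b c => M b a c) (fun b c => M b a' c)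
    have h3 : ∑ b, ((∑ c, M b a c ^ 2) * (∑ c, M b a' c ^ 2) -
      (∑ c, M b a c * M b a' c) ^ 2) ≤ ∑ b, (∑ c, M b a c ^ 2) * (∑ c, M b a' c ^ 2) :=
      Finset.sum_le_sum fun b _ => sub_le_self _ (sq_nonneg _)
    have e : ∀ a, ∑ b, ∑ c, M b a c ^ 2 = α a a := by
      intro a; rw [← tri_left h hγ]; simp only [pow_two]
    simp only [e, tri_left h hγ] at h2
    have hN : (√(α a a) * √(α a' a')) ^ 2 = α a a * α a' a' := by
      rw [mul_pow, Real.sq_sqrt (hα0 _ _), Real.sq_sqrt (hα0 _ _)]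
    rw [← hN] at h2
    set N := √(α a a) * √(α a' a')
    have hN0 : 0 ≤ N := by positivity
    have hx := hα0 a a'
    have hnn : 0 ≤ N ^ 2 - α a a' ^ 2 := le_trans (Finset.sum_nonneg fun b _ => by
      rw [sub_nonneg]; exact Finset.sum_mul_sq_le_sq_mul_sq _ _ _) h2
    have hxN : α a a' ≤ N := by nlinarith
    rcases le_total (3 * α a a') (2 * N) with hc | hc <;> nlinarith
  calc _ = ∑ a, ∑ a', ∑ b, ((∑ c, M b a c ^ 2) * (∑ c, M b a' c ^ 2) -
      (∑ c, M b a c * M b a' c) ^ 2) := by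
        have : ∀ b, frobSq (M b) ^ 2 - gramSq (M b) = ∑ a, ∑ a',
          ((∑ c, M b a c ^ 2) * (∑ c, M b a' c ^ 2) - (∑ c, M b a c * M b a' c) ^ 2) := by
          intro b
          simp only [Finset.sum_sub_distrib, frobSq, gramSq, pow_two (∑ a, ∑ c, M b a c ^ 2),
            Finset.sum_mul_sum]
        simp only [this]
        rw [Finset.sum_comm]
        exact Finset.sum_congr rfl fun _ _ => Finset.sum_comm
    _ ≤ ∑ a, ∑ a', 3 * (√(α a a) * √(α a' a') * α a a' - α a a' ^ 2) :=
        Finset.sum_le_sum fun a _ => Finset.sum_le_sum fun a' _ => key a a'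
    _ = _ := by simp only [← Finset.mul_sum, Finset.sum_sub_distrib]

end tripartite

section tripartite

variable {A B C : Type*} [Fintype A] [Fintype B] [Fintype C]
variable {M : B → A → C → ℝ} {α : A → A → ℝ} {γ : C → C → ℝ}

theorem sq_sum_mul_mul_le {C : Type*} [Fintype C] (w : C → ℝ) (D : C → C → ℝ) :
    (∑ c, ∑ c', w c * w c' * D c c') ^ 2 ≤ (∑ c, w c ^ 2) ^ 2 * ∑ c, ∑ c', D c c' ^ 2 := by
  have h1 := Finset.sum_mul_sq_le_sq_mul_sq (Finset.univ : Finset (C × C))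
    (fun u => w u.1 * w u.2) (fun u => D u.1 u.2)
  simp only [← Finset.univ_product_univ, Finset.sum_product] at h1
  refine h1.trans (le_of_eq ?_)
  congr 1
  rw [pow_two, Finset.sum_mul_sum]
  simp only [mul_pow]

theorem sum_frobSq_eq_one (h : ∀ a a' c c', ∑ b, M b a c * M b a' c' = α a a' * γ c c')
    (hα : ∑ a, α a a = 1) (hγ : ∑ c, γ c c = 1) : ∑ b, frobSq (M b) = 1 := by
  unfold frobSq
  rw [Finset.sum_comm, ← hα]
  refine Finset.sum_congr rfl fun a _ => ?_
  rw [← tri_left h hγ]; simp only [pow_two]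

theorem eq_zero_of_frobSq_eq_zero {A C : Type*} [Fintype A] [Fintype C] {N : A → C → ℝ}
    (hN : frobSq N = 0) (a : A) (c : C) : N a c = 0 := by
  unfold frobSq at hN
  rw [Finset.sum_eq_zero_iff_of_nonneg
    fun _ _ => Finset.sum_nonneg fun _ _ => sq_nonneg _] at hN
  have := hN a (Finset.mem_univ _)
  rw [Finset.sum_eq_zero_iff_of_nonneg fun _ _ => sq_nonneg _] at this
  exact pow_eq_zero_iff (two_ne_zero) |>.1 (this c (Finset.mem_univ _))

/-- The average linear entropy deficit of the right part, as a sum of squared distances. -/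
theorem sum_dist_sq_eq (h : ∀ a a' c c', ∑ b, M b a c * M b a' c' = α a a' * γ c c')
    (hα : ∑ a, α a a = 1) (hγ : ∑ c, γ c c = 1) :
    ∑ b, frobSq (M b) *
        ∑ c, ∑ c', ((∑ a, M b a c * M b a c') / frobSq (M b) - γ c c') ^ 2 =
      ∑ b, gramSq (M b) / frobSq (M b) - ∑ c, ∑ c', γ c c' ^ 2 := by
  have e1 : ∀ b, frobSq (M b) *
      ∑ c, ∑ c', ((∑ a, M b a c * M b a c') / frobSq (M b) - γ c c') ^ 2 =
      gramSq (M b) / frobSq (M b) - 2 * (∑ c, ∑ c', (∑ a, M b a c * M b a c') * γ c c') +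
        frobSq (M b) * ∑ c, ∑ c', γ c c' ^ 2 := by
    intro b
    by_cases hp : frobSq (M b) = 0
    · have := eq_zero_of_frobSq_eq_zero hp
      simp [hp, this]
    · rw [← gramSq_swap (M b)]
      unfold gramSq
      simp only [sub_sq, Finset.sum_add_distrib, Finset.sum_sub_distrib, div_pow,
        ← Finset.sum_div, mul_add, mul_sub]
      congr 2
      · field_simp
      · simp only [Finset.mul_sum]
        refine Finset.sum_congr rfl fun _ _ => Finset.sum_congr rfl fun _ _ => ?_
        field_simp
  have e2 : ∑ b, ∑ c, ∑ c', (∑ a, M b a c * M b a c') * γ c c' = ∑ c, ∑ c', γ c c' ^ 2 := by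
    rw [Finset.sum_comm]
    refine Finset.sum_congr rfl fun c _ => ?_
    rw [Finset.sum_comm]
    refine Finset.sum_congr rfl fun c' _ => ?_
    rw [← Finset.sum_mul, tri_left (tri_swap h) hα, pow_two]
  simp only [e1, Finset.sum_add_distrib, Finset.sum_sub_distrib, ← Finset.mul_sum, e2,
    ← Finset.sum_mul, sum_frobSq_eq_one h hα hγ]
  ring

theorem overlap_sub_sq_le (hM : ∀ b a c, 0 ≤ M b a c)
    (h : ∀ a a' c c', ∑ b, M b a c * M b a' c' = α a a' * γ c c')
    (hα : ∑ a, α a a = 1) (hγ : ∑ c, γ c c = 1) :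
    (∑ a, ∑ a', √(α a a) * √(α a' a') * α a a') *
      ((∑ a, ∑ a', √(α a a) * √(α a' a') * α a a') - ∑ c, ∑ c', γ c c' ^ 2) ≤
      √(∑ b, gramSq (M b) / frobSq (M b) - ∑ c, ∑ c', γ c c' ^ 2) := by
  have hα0 := tri_left_nonneg hM h hγ
  set m := ∑ a, ∑ a', √(α a a) * √(α a' a') * α a a' with hm
  set t := ∑ c, ∑ c', γ c c' ^ 2 with ht
  set n : A → ℝ := fun a => √(α a a) with hn
  have hn1 : ∑ a, n a ^ 2 = 1 := by
    rw [← hα]; exact Finset.sum_congr rfl fun a _ => Real.sq_sqrt (hα0 a a)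
  set w : B → C → ℝ := fun b c => ∑ a, M b a c * n a with hw
  set G : B → C → C → ℝ := fun b c c' => ∑ a, M b a c * M b a c' with hG
  set v : B → A → ℝ := fun b a => ∑ c, M b a c * w b c with hv
  set p : B → ℝ := fun b => frobSq (M b) with hp
  have hp0 : ∀ b, 0 ≤ p b := fun b => frobSq_nonneg _
  have hp1 : ∑ b, p b = 1 := sum_frobSq_eq_one h hα hγ
  have hpz : ∀ b, p b = 0 → ∀ a c, M b a c = 0 := fun b hb => eq_zero_of_frobSq_eq_zero hb
  have hww : ∀ b, ∑ c, w b c ^ 2 ≤ p b := by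
    intro b
    rw [hp]; simp only; rw [← frobSq_swap]
    refine Finset.sum_le_sum fun c _ => ?_
    have := Finset.sum_mul_sq_le_sq_mul_sq Finset.univ (fun a => M b a c) n
    rwa [hn1, mul_one] at this
  have hvsum : ∀ a, ∑ b, v b a = ∑ a', n a' * α a a' := by
    intro a
    simp only [hv, hw, Finset.mul_sum]
    calc _ = ∑ a', ∑ b, ∑ c, M b a c * (M b a' c * n a') := by
          rw [Finset.sum_comm' (t' := Finset.univ) (s' := fun _ => Finset.univ) (by simp)]
          rw [Finset.sum_comm]
          rw [Finset.sum_congr rfl fun b _ => Finset.sum_comm]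
          rw [Finset.sum_comm]
      _ = _ := by
          refine Finset.sum_congr rfl fun a' _ => ?_
          rw [← tri_left h hγ, Finset.mul_sum]
          refine Finset.sum_congr rfl fun b _ => ?_
          rw [Finset.mul_sum]
          exact Finset.sum_congr rfl fun _ _ => by ring
  have hmv : m = ∑ a, n a * ∑ b, v b a := by
    simp only [hvsum, hm, Finset.mul_sum]
    exact Finset.sum_congr rfl fun _ _ => Finset.sum_congr rfl fun _ _ => by
      simp only [hn]; ring
  have hvsq : ∀ b, ∑ a, v b a ^ 2 = ∑ c, ∑ c', w b c * w b c' * G b c c' := by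
    intro b
    have e : ∀ a, v b a ^ 2 = ∑ c, ∑ c', M b a c * w b c * (M b a c' * w b c') := by
      intro a; simp only [hv]; rw [pow_two, Finset.sum_mul_sum]
    simp only [e, hG, Finset.mul_sum]
    rw [Finset.sum_comm]
    refine Finset.sum_congr rfl fun c _ => ?_
    rw [Finset.sum_comm]
    exact Finset.sum_congr rfl fun _ _ => Finset.sum_congr rfl fun _ _ => by ring
  have hm2 : m ^ 2 ≤ ∑ b, p b * ∑ c, ∑ c', w b c / p b * (w b c' / p b) * G b c c' := by
    calc m ^ 2 ≤ (∑ a, n a ^ 2) * ∑ a, (∑ b, v b a) ^ 2 := by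
          rw [hmv]; exact Finset.sum_mul_sq_le_sq_mul_sq _ _ _
      _ = ∑ a, (∑ b, p b * (v b a / p b)) ^ 2 := by
          rw [hn1, one_mul]
          refine Finset.sum_congr rfl fun a _ => ?_
          congr 1
          refine Finset.sum_congr rfl fun b _ => ?_
          by_cases hb : p b = 0
          · simp [hv, hpz b hb]
          · field_simp
      _ ≤ ∑ a, ∑ b, p b * (v b a / p b) ^ 2 :=
          Finset.sum_le_sum fun a _ => weighted_sq_le _ _ _ (fun b _ => hp0 b) hp1
      _ = _ := by
          rw [Finset.sum_comm]
          refine Finset.sum_congr rfl fun b _ => ?_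
          rw [← Finset.mul_sum]
          congr 1
          simp only [div_pow, ← Finset.sum_div, hvsq]
          rw [Finset.sum_div]
          refine Finset.sum_congr rfl fun c _ => ?_
          rw [Finset.sum_div]
          exact Finset.sum_congr rfl fun c' _ => by ring
  have hwsum : ∀ c c', ∑ b, w b c * w b c' = m * γ c c' := by
    intro c c'
    simp only [hw, Finset.sum_mul_sum]
    rw [Finset.sum_comm, hm, Finset.sum_mul]
    refine Finset.sum_congr rfl fun a _ => ?_
    rw [Finset.sum_comm, Finset.sum_mul]
    refine Finset.sum_congr rfl fun a' _ => ?_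
    calc _ = (n a * n a') * ∑ b, M b a c * M b a' c' := by
          rw [Finset.mul_sum]; exact Finset.sum_congr rfl fun _ _ => by ring
      _ = _ := by rw [h]; simp only [hn]; ring
  have htm : m * t = ∑ b, ∑ c, ∑ c', w b c * w b c' * γ c c' := by
    rw [Finset.sum_comm, ht, Finset.mul_sum]
    refine Finset.sum_congr rfl fun c _ => ?_
    rw [Finset.sum_comm, Finset.mul_sum]
    refine Finset.sum_congr rfl fun c' _ => ?_
    rw [← Finset.sum_mul, hwsum]; ring
  set D : B → C → C → ℝ := fun b c c' => G b c c' / p b - γ c c' with hD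
  set r : B → ℝ := fun b => ∑ c, ∑ c', w b c * w b c' * D b c c' with hr
  have hmt : m * (m - t) ≤ ∑ b, r b := by
    rw [mul_sub, htm, ← pow_two, sub_le_iff_le_add]
    refine hm2.trans (le_of_eq ?_)
    rw [← Finset.sum_add_distrib]
    refine Finset.sum_congr rfl fun b _ => ?_
    simp only [hr, ← Finset.sum_add_distrib, Finset.mul_sum]
    refine Finset.sum_congr rfl fun c _ => Finset.sum_congr rfl fun c' _ => ?_
    by_cases hb : p b = 0
    · simp [hw, hpz b hb]
    · simp only [hD]; field_simp; ring
  have hrsq : (∑ b, r b) ^ 2 ≤ ∑ b, p b * ∑ c, ∑ c', D b c c' ^ 2 := by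
    calc _ = (∑ b, p b * (r b / p b)) ^ 2 := by
          congr 1
          refine Finset.sum_congr rfl fun b _ => ?_
          by_cases hb : p b = 0
          · simp [hr, hw, hpz b hb]
          · field_simp
      _ ≤ ∑ b, p b * (r b / p b) ^ 2 := weighted_sq_le _ _ _ (fun b _ => hp0 b) hp1
      _ ≤ _ := by
          refine Finset.sum_le_sum fun b _ => mul_le_mul_of_nonneg_left ?_ (hp0 b)
          have h1 := sq_sum_mul_mul_le (w b) (D b)
          have h2 : (∑ c, w b c ^ 2) ^ 2 ≤ p b ^ 2 :=
            pow_le_pow_left₀ (Finset.sum_nonneg fun _ _ => sq_nonneg _) (hww b) 2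
          have h3 : 0 ≤ ∑ c, ∑ c', D b c c' ^ 2 :=
            Finset.sum_nonneg fun _ _ => Finset.sum_nonneg fun _ _ => sq_nonneg _
          rcases (hp0 b).eq_or_lt with hb | hb
          · simp [← hb, h3]
          · rw [div_pow, div_le_iff₀ (by positivity), mul_comm (∑ c, ∑ c', D b c c' ^ 2)]
            exact h1.trans (mul_le_mul_of_nonneg_right h2 h3)
  refine hmt.trans (Real.le_sqrt_of_sq_le (hrsq.trans (le_of_eq ?_)))
  exact sum_dist_sq_eq h hα hγ

end tripartite

/-- Measuring the middle part of a non-negative tripartite state whose outer parts are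
uncorrelated strictly decreases the average linear entropy. -/
theorem tripartite_decrease {A B C : Type*} [Fintype A] [Fintype B] [Fintype C]
    {M : B → A → C → ℝ} {α : A → A → ℝ} {γ : C → C → ℝ} (hM : ∀ b a c, 0 ≤ M b a c)
    (h : ∀ a a' c c', ∑ b, M b a c * M b a' c' = α a a' * γ c c')
    (hα : ∑ a, α a a = 1) (hγ : ∑ c, γ c c = 1) {d : ℕ} (hd : 1 ≤ d)
    (hB : Fintype.card B = d) :
    ∑ b, linEnt (M b) + (∑ b, linEnt (M b)) ^ 8 / (324 * (d : ℝ) ^ 4) ≤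
      ((1 - ∑ a, ∑ a', α a a' ^ 2) + (1 - ∑ c, ∑ c', γ c c' ^ 2)) / 2 := by
  have h1 := sum_frobSq_sub_gramSq_le hM h hα hγ
  have h2 := overlap_sub_sq_le hM h hα hγ
  have h3 := sum_dist_sq_eq h hα hγ
  have h4 := sum_dist_sq_eq (tri_swap h) hγ hα
  simp only [gramSq_swap, frobSq_swap] at h4
  have h3' := h3.symm.trans_ge (Finset.sum_nonneg fun b _ => mul_nonneg (frobSq_nonneg (M b))
    (Finset.sum_nonneg fun c _ => Finset.sum_nonneg fun c' _ => sq_nonneg _))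
  have h4' := h4.symm.trans_ge (Finset.sum_nonneg fun b _ => mul_nonneg (frobSq_nonneg (M b))
    (Finset.sum_nonneg fun c _ => Finset.sum_nonneg fun c' _ => sq_nonneg _))
  have hmm := sq_sum_mul_mul_le (fun a => √(α a a)) α
  have hα0 := tri_left_nonneg hM h hγ
  have hn1 : ∑ a, √(α a a) ^ 2 = 1 := by
    rw [← hα]; exact Finset.sum_congr rfl fun a _ => Real.sq_sqrt (hα0 a a)
  rw [hn1, one_pow, one_mul] at hmm
  have hE : ∑ b, linEnt (M b) = 1 - ∑ b, gramSq (M b) / frobSq (M b) := by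
    simp only [linEnt, Finset.sum_sub_distrib, sum_frobSq_eq_one h hα hγ]
  have hE0 : 0 ≤ ∑ b, linEnt (M b) := Finset.sum_nonneg fun b _ => linEnt_nonneg _
  have hm0 : 0 ≤ ∑ a, ∑ a', √(α a a) * √(α a' a') * α a a' :=
    Finset.sum_nonneg fun a _ => Finset.sum_nonneg fun a' _ =>
      mul_nonneg (by positivity) (hα0 _ _)
  have ha0 : 0 ≤ ∑ a, ∑ a', α a a' ^ 2 :=
    Finset.sum_nonneg fun a _ => Finset.sum_nonneg fun a' _ => sq_nonneg _
  have hEsq : (∑ b, linEnt (M b)) ^ 2 ≤ d * ∑ b, (frobSq (M b) ^ 2 - gramSq (M b)) := by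
    have := sq_sum_le_card_mul_sum_sq (s := Finset.univ) (f := fun b => linEnt (M b))
    rw [Finset.card_univ, hB] at this
    refine this.trans (mul_le_mul_of_nonneg_left (Finset.sum_le_sum fun b _ => ?_) (by positivity))
    have hb := pow_le_pow_left₀ (linEnt_nonneg (M b)) (linEnt_le_sqrt (M b)) 2
    rwa [Real.sq_sqrt (sub_nonneg.2 (gramSq_le _))] at hb
  set E := ∑ b, linEnt (M b)
  set m := ∑ a, ∑ a', √(α a a) * √(α a' a') * α a a'
  set a := ∑ a, ∑ a', α a a' ^ 2
  set t := ∑ c, ∑ c', γ c c' ^ 2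
  set T := ∑ b, gramSq (M b) / frobSq (M b)
  have hd' : (1 : ℝ) ≤ d := by exact_mod_cast hd
  have hT : T = 1 - E := by linarith
  rw [hT] at h2 h3' h4'
  set x := 1 - E - a with hx
  set y := 1 - E - t with hy
  have hx1 : x ≤ 1 := by linarith
  have hm1 : m ≤ 1 := by nlinarith
  have hu : E ^ 2 ≤ 3 * d * (m - a) := by
    refine hEsq.trans ?_
    nlinarith
  have hu0 : 0 ≤ m - a := by
    by_contra hc
    push Not at hc
    have : 0 < (d : ℝ) := by linarith
    nlinarith [sq_nonneg E]
  have hxs : x ≤ √x := Real.le_sqrt_of_sq_le (by nlinarith)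
  have hu2 : (m - a) ^ 2 ≤ √x + √y := by
    have e1 : m - t = (m - a) - x + y := by rw [hx, hy]; ring
    rw [e1] at h2
    nlinarith [mul_nonneg hm0 h3', mul_nonneg hm0 h4', mul_nonneg ha0 hu0,
      mul_nonneg (sub_nonneg.2 hm1) h4']
  have hu4 : (m - a) ^ 4 ≤ 2 * (x + y) := by
    have e := pow_le_pow_left₀ (sq_nonneg (m - a)) hu2 2
    have e1 := Real.sq_sqrt h4'
    have e2 := Real.sq_sqrt h3'
    nlinarith [sq_nonneg (√x - √y)]
  have hE8 : E ^ 8 ≤ 162 * (d : ℝ) ^ 4 * (x + y) := by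
    have e := pow_le_pow_left₀ (sq_nonneg E) hu 4
    calc E ^ 8 = (E ^ 2) ^ 4 := by ring
      _ ≤ _ := e
      _ = 81 * (d : ℝ) ^ 4 * (m - a) ^ 4 := by ring
      _ ≤ 81 * (d : ℝ) ^ 4 * (2 * (x + y)) := by gcongr
      _ = _ := by ring
  have : E ^ 8 / (324 * (d : ℝ) ^ 4) ≤ (x + y) / 2 := by
    rw [div_le_iff₀ (by positivity)]
    linarith
  rw [hx, hy] at this
  linarith

theorem linEnt_eq_zero {A C : Type*} [Fintype A] [Fintype C] {M : A → C → ℝ}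
    (h : ∀ a c, M a c = 0) : linEnt M = 0 := by
  simp [linEnt, frobSq, h]

theorem tripartite_decrease_scaled {A B C : Type*} [Fintype A] [Fintype B] [Fintype C]
    {M : B → A → C → ℝ} {α : A → A → ℝ} {γ : C → C → ℝ} (hM : ∀ b a c, 0 ≤ M b a c)
    (h : ∀ a a' c c', ∑ b, M b a c * M b a' c' = α a a' * γ c c')
    (hα : ∀ a, 0 ≤ α a a) (hγ : ∀ c, 0 ≤ γ c c) {d : ℕ} (hd : 1 ≤ d)
    (hB : Fintype.card B = d) {P Q : ℝ} (hP : ∑ a, α a a = P) (hQ : ∑ c, γ c c = Q) :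
    ∑ b, linEnt (M b) + P * Q * ((∑ b, linEnt (M b)) / (P * Q)) ^ 8 / (324 * (d : ℝ) ^ 4) ≤
      (Q * (P - (∑ a, ∑ a', α a a' ^ 2) / P) + P * (Q - (∑ c, ∑ c', γ c c' ^ 2) / Q)) / 2 := by
  have hP0 : 0 ≤ P := hP ▸ Finset.sum_nonneg fun a _ => hα a
  have hQ0 : 0 ≤ Q := hQ ▸ Finset.sum_nonneg fun c _ => hγ c
  by_cases hPQ : P * Q = 0
  · have hz : ∀ b a c, M b a c = 0 := by
      intro b a c
      have h0 : α a a * γ c c = 0 := by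
        refine le_antisymm ?_ (mul_nonneg (hα a) (hγ c))
        rw [← hPQ, ← hP, ← hQ]
        exact mul_le_mul (Finset.single_le_sum (f := fun a => α a a) (fun a _ => hα a)
          (Finset.mem_univ a)) (Finset.single_le_sum (f := fun c => γ c c) (fun c _ => hγ c)
          (Finset.mem_univ c)) (hγ c) (hP ▸ hP0)
      rw [← h] at h0
      have := (Finset.sum_eq_zero_iff_of_nonneg fun b _ => mul_self_nonneg _).1 h0 b
        (Finset.mem_univ b)
      exact mul_self_eq_zero.1 this
    have hE : ∑ b, linEnt (M b) = 0 := Finset.sum_eq_zero fun b _ => linEnt_eq_zero (hz b)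
    rw [hE, hPQ]
    rcases mul_eq_zero.1 hPQ with h0 | h0 <;> simp [h0]
  · have hP1 : 0 < P := lt_of_le_of_ne hP0 fun e => hPQ (by simp [← e])
    have hQ1 : 0 < Q := lt_of_le_of_ne hQ0 fun e => hPQ (by simp [← e])
    have hs : (√(P * Q))⁻¹ ^ 2 = (P * Q)⁻¹ := by
      rw [inv_pow, Real.sq_sqrt (by positivity)]
    have key := tripartite_decrease (M := fun b a c => (√(P * Q))⁻¹ * M b a c)
      (α := fun a a' => α a a' / P) (γ := fun c c' => γ c c' / Q)
      (fun b a c => mul_nonneg (by positivity) (hM b a c))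
      (fun a a' c c' => by
        calc _ = (√(P * Q))⁻¹ ^ 2 * ∑ b, M b a c * M b a' c' := by
              rw [Finset.mul_sum]; exact Finset.sum_congr rfl fun _ _ => by ring
          _ = _ := by rw [hs, h]; field_simp)
      (by rw [← Finset.sum_div, hP, div_self hP1.ne'])
      (by rw [← Finset.sum_div, hQ, div_self hQ1.ne']) hd hB
    simp only [linEnt_smul, ← Finset.mul_sum, hs, div_pow, ← Finset.sum_div] at key
    have key2 := mul_le_mul_of_nonneg_left key (mul_pos hP1 hQ1).le
    refine le_trans (le_of_eq ?_) (key2.trans (le_of_eq ?_))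
    · rw [div_eq_inv_mul (b := P * Q), mul_add, mul_inv_cancel_left₀ hPQ, mul_div_assoc]
    · field_simp

theorem frobSq_sq_le {A C : Type*} [Fintype A] [Fintype C] (H : A → C → ℝ) :
    frobSq H ^ 2 ≤ Fintype.card A * gramSq H := by
  have h1 := sq_sum_le_card_mul_sum_sq (s := Finset.univ) (f := fun a => ∑ c, H a c ^ 2)
  refine h1.trans (mul_le_mul_of_nonneg_left (Finset.sum_le_sum fun a _ => ?_) (by positivity))
  have := Finset.single_le_sum (f := fun a' => (∑ c, H a c * H a' c) ^ 2)
    (fun _ _ => sq_nonneg _) (Finset.mem_univ a)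
  simpa only [pow_two] using this

/-- Words of length `n` over the alphabet `Fin d`. -/
def words (d n : ℕ) : Finset (List (Fin d)) :=
  (Finset.univ : Finset (Fin n → Fin d)).image List.ofFn

section wordSums

variable {d : ℕ}

theorem mem_words {n : ℕ} {l : List (Fin d)} : l ∈ words d n ↔ l.length = n := by
  unfold words
  simp only [Finset.mem_image, Finset.mem_univ, true_and]
  constructor
  · rintro ⟨f, rfl⟩; simp
  · rintro rfl; exact ⟨l.get, List.ofFn_get l⟩

theorem words_zero : words d 0 = {[]} := by
  ext l; simp [mem_words]

theorem append_mem_words {m n : ℕ} {a c : List (Fin d)} (ha : a ∈ words d m)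
    (hc : c ∈ words d n) : a ++ c ∈ words d (m + n) := by
  rw [mem_words] at *; simp [ha, hc]

theorem cons_mem_words {n : ℕ} (b : Fin d) {c : List (Fin d)}
    (hc : c ∈ words d n) : b :: c ∈ words d (n + 1) := by
  rw [mem_words] at *; simp [hc]

theorem sum_words_add {E : Type*} [AddCommMonoid E] (m n : ℕ) (F : List (Fin d) → E) :
    ∑ l ∈ words d (m + n), F l = ∑ a ∈ words d m, ∑ c ∈ words d n, F (a ++ c) := by
  rw [← Finset.sum_product']
  refine Finset.sum_nbij' (fun l => (l.take m, l.drop m)) (fun x => x.1 ++ x.2) ?_ ?_ ?_ ?_ ?_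
  · intro l hl
    rw [mem_words] at hl
    simp [mem_words, hl]
  · rintro ⟨a, c⟩ h
    rw [Finset.mem_product] at h
    exact append_mem_words h.1 h.2
  · intro l _; simp
  · rintro ⟨a, c⟩ h
    rw [Finset.mem_product] at h
    have := mem_words.1 h.1
    simp at this
    simp [← this]
  · intro l _; simp

theorem sum_words_cons {E : Type*} [AddCommMonoid E] (n : ℕ) (F : List (Fin d) → E) :
    ∑ l ∈ words d (n + 1), F l = ∑ b : Fin d, ∑ c ∈ words d n, F (b :: c) := by
  rw [← Finset.sum_product']
  refine (Finset.sum_nbij (fun x => x.1 :: x.2) ?_ ?_ ?_ ?_).symm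
  · rintro ⟨b, c⟩ h
    rw [Finset.mem_product] at h
    exact cons_mem_words b h.2
  · rintro ⟨b, c⟩ _ ⟨b', c'⟩ _ e
    simpa using e
  · intro l hl
    rw [Finset.mem_coe, mem_words] at hl
    cases l with
    | nil => simp at hl
    | cons b c =>
      refine ⟨(b, c), ?_, rfl⟩
      simp at hl
      simp [mem_words, hl]
  · intro x _; rfl

theorem sum_words_middle {E : Type*} [AddCommMonoid E] (m n : ℕ) (F : List (Fin d) → E) :
    ∑ l ∈ words d (m + (n + 1)), F l =
      ∑ a ∈ words d m, ∑ c ∈ words d n, ∑ b : Fin d, F (a ++ b :: c) := by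
  rw [sum_words_add]
  refine Finset.sum_congr rfl fun a _ => ?_
  rw [sum_words_cons, Finset.sum_comm]

end wordSums

/-- Non-negative normalised amplitudes of a line of `L` sites, given on words, for which the
reduced states to the left and to the right of any site are uncorrelated. -/
structure WordState (d L : ℕ) (ψ : List (Fin d) → ℝ) : Prop where
  nonneg : ∀ l, 0 ≤ ψ l
  norm : ∑ l ∈ words d L, ψ l ^ 2 = 1
  split : ∀ m p, m + (p + 1) = L → ∀ a ∈ words d m, ∀ a' ∈ words d m, ∀ c ∈ words d p,
    ∀ c' ∈ words d p, ∑ b, ψ (a ++ b :: c) * ψ (a' ++ b :: c') =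
      (∑ w ∈ words d (p + 1), ψ (a ++ w) * ψ (a' ++ w)) *
        ∑ w ∈ words d (m + 1), ψ (w ++ c) * ψ (w ++ c')

/-- The amplitude matrix between the outer segments, of lengths `m` and `p`, for the outcome `s`
on the middle segment. -/
def segMat {d : ℕ} (ψ : List (Fin d) → ℝ) (m p : ℕ) (s : List (Fin d)) :
    words d m → words d p → ℝ :=
  fun a c => ψ (a.1 ++ (s ++ c.1))

/-- The average linear entropy after measuring the middle segment, of length `n`. -/
noncomputable def avgLinEnt {d : ℕ} (ψ : List (Fin d) → ℝ) (m n p : ℕ) : ℝ :=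
  ∑ s ∈ words d n, linEnt (segMat ψ m p s)

section chain

variable {d L : ℕ} {ψ : List (Fin d) → ℝ}

theorem frobSq_segMat (m p : ℕ) (s : List (Fin d)) :
    frobSq (segMat ψ m p s) = ∑ a ∈ words d m, ∑ c ∈ words d p, ψ (a ++ (s ++ c)) ^ 2 := by
  unfold frobSq segMat
  rw [← Finset.sum_coe_sort (words d m)]
  refine Finset.sum_congr rfl fun a _ => ?_
  rw [← Finset.sum_coe_sort (words d p)]

theorem avgLinEnt_nonneg (m n p : ℕ) : 0 ≤ avgLinEnt ψ m n p :=
  Finset.sum_nonneg fun _ _ => linEnt_nonneg _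

theorem WordState.sum_frobSq (hψ : WordState d L ψ) {m n p : ℕ} (h : m + n + p = L) :
    ∑ s ∈ words d n, frobSq (segMat ψ m p s) = 1 := by
  rw [← hψ.norm, ← h, add_assoc, sum_words_add]
  simp only [frobSq_segMat]
  rw [Finset.sum_comm]
  refine Finset.sum_congr rfl fun a _ => ?_
  rw [sum_words_add]

theorem WordState.pos_d (hψ : WordState d L ψ) {m n p : ℕ} (h : m + 1 + n + p = L) : 1 ≤ d := by
  rcases Nat.eq_zero_or_pos d with rfl | h0
  · exfalso
    have h1 := hψ.norm
    have e : L = (m + n + p) + 1 := by omega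
    rw [e, sum_words_cons] at h1
    simp at h1
  · exact h0

theorem WordState.avgLinEnt_step (hψ : WordState d L ψ) {m n k p : ℕ}
    (h : m + (n + (k + 1)) + p = L) :
    avgLinEnt ψ m (n + (k + 1)) p + avgLinEnt ψ m (n + (k + 1)) p ^ 8 / (324 * (d : ℝ) ^ 4) ≤
      (avgLinEnt ψ m n (k + p + 1) + avgLinEnt ψ (m + n + 1) k p) / 2 := by
  have hd : 1 ≤ d := hψ.pos_d (m := m) (n := n + k) (p := p) (by omega)
  set P : List (Fin d) → ℝ := fun s => frobSq (segMat ψ m (k + p + 1) s) with hP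
  set Q : List (Fin d) → ℝ := fun s => frobSq (segMat ψ (m + n + 1) p s) with hQ
  have hP1 : ∑ s ∈ words d n, P s = 1 := hψ.sum_frobSq (by omega)
  have hQ1 : ∑ s ∈ words d k, Q s = 1 := hψ.sum_frobSq (by omega)
  set E : List (Fin d) → List (Fin d) → ℝ := fun s t =>
    ∑ b : Fin d, linEnt (segMat ψ m p (s ++ b :: t)) with hE
  have hsum : avgLinEnt ψ m (n + (k + 1)) p = ∑ s ∈ words d n, ∑ t ∈ words d k, E s t := by
    unfold avgLinEnt
    rw [sum_words_middle]
  have hstep : ∀ s ∈ words d n, ∀ t ∈ words d k,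
      E s t + P s * Q t * (E s t / (P s * Q t)) ^ 8 / (324 * (d : ℝ) ^ 4) ≤
        (Q t * linEnt (segMat ψ m (k + p + 1) s) +
          P s * linEnt (segMat ψ (m + n + 1) p t)) / 2 := by
    intro s hs t ht
    have key := tripartite_decrease_scaled
      (M := fun b => segMat ψ m p (s ++ b :: t))
      (α := fun a a' => ∑ w, segMat ψ m (k + p + 1) s a w * segMat ψ m (k + p + 1) s a' w)
      (γ := fun c c' => ∑ w, segMat ψ (m + n + 1) p t w c * segMat ψ (m + n + 1) p t w c')
      (fun b a c => hψ.nonneg _)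
      (fun a a' c c' => by
        have := hψ.split (m + n) (k + p) (by omega) _ (append_mem_words a.2 hs) _
          (append_mem_words a'.2 hs) _ (append_mem_words ht c.2) _ (append_mem_words ht c'.2)
        simp only [segMat, List.append_assoc, List.cons_append] at this ⊢
        rw [this, ← Finset.sum_coe_sort (words d (k + p + 1)),
          ← Finset.sum_coe_sort (words d (m + n + 1))])
      (fun a => Finset.sum_nonneg fun _ _ => mul_self_nonneg _)
      (fun c => Finset.sum_nonneg fun _ _ => mul_self_nonneg _) hd (Fintype.card_fin d)
      (P := P s) (Q := Q t) (by simp only [hP, frobSq, pow_two])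
      (by simp only [hQ]; rw [← frobSq_swap]; simp only [frobSq, pow_two])
    have el : linEnt (segMat ψ (m + n + 1) p t) = Q t -
        (∑ c, ∑ c', (∑ w, segMat ψ (m + n + 1) p t w c * segMat ψ (m + n + 1) p t w c') ^ 2) /
          Q t := by
      rw [← linEnt_swap, linEnt, frobSq_swap]; rfl
    rw [el]
    exact key
  have hP0 : ∀ s, 0 ≤ P s := fun s => frobSq_nonneg _
  have hQ0 : ∀ s, 0 ≤ Q s := fun s => frobSq_nonneg _
  have htot := Finset.sum_le_sum fun s hs => Finset.sum_le_sum fun t ht => hstep s hs t ht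
  have hz : ∀ s ∈ words d n, ∀ t ∈ words d k, P s * Q t = 0 → E s t = 0 := by
    intro s hs t ht h0
    have := hstep s hs t ht
    refine le_antisymm ?_ (Finset.sum_nonneg fun b _ => linEnt_nonneg _)
    rcases mul_eq_zero.1 h0 with h1 | h1
    · have e : linEnt (segMat ψ m (k + p + 1) s) = 0 :=
        linEnt_eq_zero (eq_zero_of_frobSq_eq_zero h1)
      simpa [h1, e] using this
    · have e : linEnt (segMat ψ (m + n + 1) p t) = 0 :=
        linEnt_eq_zero (eq_zero_of_frobSq_eq_zero h1)
      simpa [h1, e] using this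
  have hJ : (∑ s ∈ words d n, ∑ t ∈ words d k, E s t) ^ 8 ≤
      ∑ s ∈ words d n, ∑ t ∈ words d k, P s * Q t * (E s t / (P s * Q t)) ^ 8 := by
    have := Real.pow_arith_mean_le_arith_mean_pow_of_even (words d n ×ˢ words d k)
      (fun x => P x.1 * Q x.2) (fun x => E x.1 x.2 / (P x.1 * Q x.2))
      (fun x _ => mul_nonneg (hP0 _) (hQ0 _))
      (by rw [Finset.sum_product, ← Finset.sum_mul_sum, hP1, hQ1, one_mul])
      (n := 8) ⟨4, rfl⟩
    rw [Finset.sum_product, Finset.sum_product] at this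
    refine le_trans (le_of_eq ?_) this
    congr 1
    refine Finset.sum_congr rfl fun s hs => Finset.sum_congr rfl fun t ht => ?_
    by_cases h0 : P s * Q t = 0
    · simp [h0, hz s hs t ht h0]
    · rw [mul_div_assoc', mul_div_cancel_left₀ _ h0]
  simp only [Finset.sum_add_distrib, ← Finset.sum_div, ← Finset.mul_sum, ← Finset.sum_mul,
    hP1, hQ1, one_mul] at htot
  rw [hsum]
  refine le_trans (add_le_add_right (div_le_div_of_nonneg_right hJ (by positivity)) _) ?_
  exact htot

theorem WordState.exists_pos_row (hψ : WordState d L ψ) {m n : ℕ} (h : m + n = L) :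
    ∃ a ∈ words d m, 0 < ∑ w ∈ words d n, ψ (a ++ w) * ψ (a ++ w) := by
  by_contra hc
  push Not at hc
  have h1 := hψ.norm
  rw [← h, sum_words_add] at h1
  simp only [pow_two] at h1
  have := Finset.sum_nonpos hc
  linarith

/-- A decomposition of the outcome-resolved state between the right segment and the last site of
the left segment. -/
theorem WordState.exists_row_factor (hψ : WordState d L ψ) {m n p : ℕ} (h : m + 1 + n + p = L) :
    ∃ a ∈ words d m, 0 < ∑ w ∈ words d (n + p + 1), ψ (a ++ w) * ψ (a ++ w) ∧
      ∀ s ∈ words d n, ∀ c c' : words d p,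
        ∑ b : Fin d, ψ (a ++ b :: (s ++ c)) * ψ (a ++ b :: (s ++ c')) =
          (∑ w ∈ words d (n + p + 1), ψ (a ++ w) * ψ (a ++ w)) *
            ∑ w, segMat ψ (m + 1) p s w c * segMat ψ (m + 1) p s w c' := by
  obtain ⟨a, ha, hF⟩ := hψ.exists_pos_row (m := m) (n := n + p + 1) (by omega)
  refine ⟨a, ha, hF, fun s hs c c' => ?_⟩
  rw [hψ.split m (n + p) (by omega) a ha a ha _ (append_mem_words hs c.2) _
    (append_mem_words hs c'.2), ← Finset.sum_coe_sort (words d (m + 1))]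
  rfl

theorem WordState.avgLinEnt_base (hψ : WordState d L ψ) {m n p : ℕ} (h : m + 1 + n + p = L) :
    avgLinEnt ψ (m + 1) n p ≤ 1 - 1 / d := by
  have hd : 1 ≤ d := hψ.pos_d h
  have hd' : (0 : ℝ) < d := by exact_mod_cast hd
  obtain ⟨a, -, hF, hHH⟩ := hψ.exists_row_factor h
  set F := ∑ w ∈ words d (n + p + 1), ψ (a ++ w) * ψ (a ++ w)
  rw [le_sub_comm, avgLinEnt, ← hψ.sum_frobSq h, ← Finset.sum_sub_distrib, Finset.sum_div]
  refine Finset.sum_le_sum fun s hs => ?_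
  unfold linEnt
  rw [sub_sub_cancel]
  set H : Fin d → words d p → ℝ := fun b c => ψ (a ++ b :: (s ++ c)) with hH
  have hf : frobSq H = F * frobSq (segMat ψ (m + 1) p s) := by
    rw [← frobSq_swap H, ← frobSq_swap (segMat ψ (m + 1) p s)]
    simp only [frobSq, pow_two, hH, hHH s hs, Finset.mul_sum]
  have hg : gramSq H = F ^ 2 * gramSq (segMat ψ (m + 1) p s) := by
    rw [← gramSq_swap H, ← gramSq_swap (segMat ψ (m + 1) p s)]
    simp only [gramSq, hH, hHH s hs, ← Finset.mul_sum, mul_pow]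
  have hle := frobSq_sq_le H
  rw [hf, hg, Fintype.card_fin] at hle
  have hle' : frobSq (segMat ψ (m + 1) p s) ^ 2 ≤ d * gramSq (segMat ψ (m + 1) p s) := by
    have : 0 < F ^ 2 := by positivity
    nlinarith
  rcases (frobSq_nonneg (segMat ψ (m + 1) p s)).eq_or_lt with h0 | h0
  · simp [← h0]
  · rw [div_le_div_iff₀ hd' h0]; linarith

theorem WordState.avgLinEnt_iterate (k : ℕ) {η : ℝ} (hη : 0 ≤ η) :
    ∀ {L : ℕ} {ψ : List (Fin d) → ℝ}, WordState d L ψ → ∀ {m p : ℕ},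
      m + 1 + (2 ^ k - 1) + p = L →
      avgLinEnt ψ (m + 1) (2 ^ k - 1) p ≤ max η (1 - k * (η ^ 8 / (324 * (d : ℝ) ^ 4))) := by
  induction k with
  | zero =>
    intro L ψ hψ m p h
    refine (hψ.avgLinEnt_base h).trans (le_max_of_le_right ?_)
    simp
  | succ k ih =>
    intro L ψ hψ m p h
    have e : 2 ^ (k + 1) - 1 = (2 ^ k - 1) + ((2 ^ k - 1) + 1) := by
      have := Nat.one_le_two_pow (n := k)
      rw [pow_succ]; omega
    rw [e] at h ⊢
    have hs := hψ.avgLinEnt_step h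
    have h1 := ih hψ (m := m) (p := 2 ^ k - 1 + p + 1) (by omega)
    have h2 := ih hψ (m := m + 1 + (2 ^ k - 1)) (p := p) (by omega)
    set x := avgLinEnt ψ (m + 1) (2 ^ k - 1 + (2 ^ k - 1 + 1)) p
    have hx : 0 ≤ x := avgLinEnt_nonneg _ _ _
    have hK : 0 ≤ x ^ 8 / (324 * (d : ℝ) ^ 4) := by positivity
    by_cases hxe : x ≤ η
    · exact le_max_of_le_left hxe
    push Not at hxe
    refine le_max_of_le_right ?_
    have hmono : η ^ 8 / (324 * (d : ℝ) ^ 4) ≤ x ^ 8 / (324 * (d : ℝ) ^ 4) := by gcongr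
    have hle : x + x ^ 8 / (324 * (d : ℝ) ^ 4) ≤ max η (1 - k * (η ^ 8 / (324 * (d : ℝ) ^ 4))) := by
      linarith
    rcases le_max_iff.1 hle with h3 | h3
    · linarith
    · push_cast; linarith

theorem exists_avgLinEnt_le {d : ℕ} (hd : 1 ≤ d) {η : ℝ} (hη : 0 < η) :
    ∃ n : ℕ, ∀ {L : ℕ} {ψ : List (Fin d) → ℝ}, WordState d L ψ → ∀ {m p : ℕ},
      m + 1 + n + p = L → avgLinEnt ψ (m + 1) n p ≤ η := by
  have hd' : (0 : ℝ) < d := by exact_mod_cast hd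
  have hK : 0 < η ^ 8 / (324 * (d : ℝ) ^ 4) := by positivity
  obtain ⟨k, hk⟩ := exists_nat_ge (1 / (η ^ 8 / (324 * (d : ℝ) ^ 4)))
  refine ⟨2 ^ k - 1, fun hψ m p h => (WordState.avgLinEnt_iterate k hη.le hψ h).trans ?_⟩
  refine max_le le_rfl ?_
  rw [div_le_iff₀ hK] at hk
  linarith

end chain

section area

variable {ι κ : Type*}

/-- Area of the parallelogram spanned by the restrictions of `f` and `g` to `T`. -/
noncomputable def area (T : Finset κ) (f g : κ → ℝ) : ℝ :=
  √((∑ c ∈ T, f c ^ 2) * (∑ c ∈ T, g c ^ 2) - (∑ c ∈ T, f c * g c) ^ 2)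

theorem area_nonneg (T : Finset κ) (f g : κ → ℝ) : 0 ≤ area T f g := Real.sqrt_nonneg _

theorem area_sq (T : Finset κ) (f g : κ → ℝ) :
    area T f g ^ 2 = (∑ c ∈ T, f c ^ 2) * (∑ c ∈ T, g c ^ 2) - (∑ c ∈ T, f c * g c) ^ 2 :=
  Real.sq_sqrt (sub_nonneg.2 (Finset.sum_mul_sq_le_sq_mul_sq _ _ _))

theorem area_le (T : Finset κ) (f g : κ → ℝ) :
    area T f g ≤ √(∑ c ∈ T, f c ^ 2) * √(∑ c ∈ T, g c ^ 2) := by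
  rw [← Real.sqrt_mul (Finset.sum_nonneg fun _ _ => sq_nonneg _)]
  exact Real.sqrt_le_sqrt (sub_le_self _ (sq_nonneg _))

theorem sum_shear_sq (T : Finset κ) (f g : κ → ℝ) (t : ℝ) :
    ∑ c ∈ T, (g c - t * f c) ^ 2 =
      ∑ c ∈ T, g c ^ 2 - 2 * t * ∑ c ∈ T, f c * g c + t ^ 2 * ∑ c ∈ T, f c ^ 2 := by
  simp only [Finset.mul_sum, ← Finset.sum_add_distrib, ← Finset.sum_sub_distrib]
  exact Finset.sum_congr rfl fun _ _ => by ring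

theorem area_shear (T : Finset κ) (f g : κ → ℝ) (t : ℝ) :
    area T f (fun c => g c - t * f c) = area T f g := by
  have e : ∑ c ∈ T, f c * (g c - t * f c) = ∑ c ∈ T, f c * g c - t * ∑ c ∈ T, f c ^ 2 := by
    simp only [Finset.mul_sum, ← Finset.sum_sub_distrib]
    exact Finset.sum_congr rfl fun _ _ => by ring
  unfold area
  congr 1
  rw [sum_shear_sq, e]
  ring

/-- The areas spanned by blocks of two vectors add up to at most the area they span. -/
theorem sum_area_le (S : Finset ι) (T : Finset κ) (f g : ι → κ → ℝ) :
    ∑ s ∈ S, area T (f s) (g s) ≤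
      √((∑ s ∈ S, ∑ c ∈ T, f s c ^ 2) * (∑ s ∈ S, ∑ c ∈ T, g s c ^ 2) -
        (∑ s ∈ S, ∑ c ∈ T, f s c * g s c) ^ 2) := by
  have hF0 : ∀ s, 0 ≤ ∑ c ∈ T, f s c ^ 2 := fun s => Finset.sum_nonneg fun _ _ => sq_nonneg _
  set F := ∑ s ∈ S, ∑ c ∈ T, f s c ^ 2 with hF
  set H := ∑ s ∈ S, ∑ c ∈ T, g s c ^ 2
  set G := ∑ s ∈ S, ∑ c ∈ T, f s c * g s c
  rcases (Finset.sum_nonneg fun s _ => hF0 s : 0 ≤ F).eq_or_lt with h0 | h0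
  · have : ∀ s ∈ S, area T (f s) (g s) = 0 := by
      intro s hs
      have h1 := (Finset.sum_eq_zero_iff_of_nonneg fun s _ => hF0 s).1 h0.symm s hs
      have := area_le T (f s) (g s)
      rw [h1] at this
      simp only [Real.sqrt_zero, zero_mul] at this
      exact le_antisymm this (area_nonneg _ _ _)
    rw [Finset.sum_eq_zero this]
    exact Real.sqrt_nonneg _
  · have h1 : ∀ s ∈ S, area T (f s) (g s) ≤
        √(∑ c ∈ T, f s c ^ 2) * √(∑ c ∈ T, (g s c - G / F * f s c) ^ 2) := by
      intro s _
      rw [← area_shear _ _ _ (G / F)]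
      exact area_le _ _ _
    refine (Finset.sum_le_sum h1).trans ((Real.sum_sqrt_mul_sqrt_le S hF0
      (fun s => Finset.sum_nonneg fun _ _ => sq_nonneg _)).trans (le_of_eq ?_))
    rw [← Real.sqrt_mul h0.le]
    congr 1
    simp only [sum_shear_sq, Finset.sum_add_distrib, Finset.sum_sub_distrib, ← Finset.mul_sum]
    have hne : F ≠ 0 := h0.ne'
    change F * (H - 2 * (G / F) * G + (G / F) ^ 2 * F) = F * H - G ^ 2
    field_simp
    ring

/-- If both vectors factorise after summing over the first index, their block areas are controlled
by the linear entropy of the common factor. -/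
theorem sum_area_le_of_factor {B : Type*} [Fintype B] {d : ℕ} (hB : Fintype.card B = d)
    (T : Finset κ) (f g : B → κ → ℝ) (R : κ → κ → ℝ) {F H : ℝ} (hF : 0 ≤ F) (hH : 0 ≤ H)
    (hf : ∀ c ∈ T, ∀ c' ∈ T, ∑ b, f b c * f b c' = F * R c c')
    (hg : ∀ c ∈ T, ∀ c' ∈ T, ∑ b, g b c * g b c' = H * R c c') :
    ∑ b, area T (f b) (g b) ≤
      √(F * H) * √d * √((∑ c ∈ T, R c c) ^ 2 - ∑ c ∈ T, ∑ c' ∈ T, R c c' ^ 2) := by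
  rw [← Real.sqrt_mul (by positivity), ← Real.sqrt_mul (by positivity)]
  apply Real.le_sqrt_of_sq_le
  have h1 := sq_sum_le_card_mul_sum_sq (s := Finset.univ) (f := fun b => area T (f b) (g b))
  rw [Finset.card_univ, hB] at h1
  rw [mul_comm (F * H), mul_assoc]
  refine h1.trans (mul_le_mul_of_nonneg_left ?_ (by positivity))
  have ef : ∑ b, ∑ c ∈ T, f b c ^ 2 = F * ∑ c ∈ T, R c c := by
    rw [Finset.sum_comm, Finset.mul_sum]
    refine Finset.sum_congr rfl fun c hc => ?_
    rw [← hf c hc c hc]; simp only [pow_two]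
  have eg : ∑ b, ∑ c ∈ T, g b c ^ 2 = H * ∑ c ∈ T, R c c := by
    rw [Finset.sum_comm, Finset.mul_sum]
    refine Finset.sum_congr rfl fun c hc => ?_
    rw [← hg c hc c hc]; simp only [pow_two]
  have ex : ∑ b, ∑ b', (∑ c ∈ T, f b c * g b' c) ^ 2 =
      F * H * ∑ c ∈ T, ∑ c' ∈ T, R c c' ^ 2 := by
    have e1 : ∀ b b', (∑ c ∈ T, f b c * g b' c) ^ 2 =
        ∑ c ∈ T, ∑ c' ∈ T, (f b c * f b c') * (g b' c * g b' c') := by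
      intro b b'
      rw [pow_two, Finset.sum_mul_sum]
      exact Finset.sum_congr rfl fun _ _ => Finset.sum_congr rfl fun _ _ => by ring
    simp only [e1]
    rw [← Finset.sum_product', Finset.mul_sum]
    rw [Finset.sum_comm]
    refine Finset.sum_congr rfl fun c hc => ?_
    rw [Finset.sum_comm, Finset.mul_sum]
    refine Finset.sum_congr rfl fun c' hc' => ?_
    rw [Finset.sum_product]
    simp only
    rw [← Finset.sum_mul_sum, hf c hc c' hc', hg c hc c' hc']
    ring
  calc ∑ b, area T (f b) (g b) ^ 2
      = ∑ b, ((∑ c ∈ T, f b c ^ 2) * (∑ c ∈ T, g b c ^ 2) - (∑ c ∈ T, f b c * g b c) ^ 2) := by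
        simp only [area_sq]
    _ ≤ ∑ b, ∑ b', ((∑ c ∈ T, f b c ^ 2) * (∑ c ∈ T, g b' c ^ 2) -
          (∑ c ∈ T, f b c * g b' c) ^ 2) := by
        refine Finset.sum_le_sum fun b _ => ?_
        exact Finset.single_le_sum (f := fun b' => (∑ c ∈ T, f b c ^ 2) * (∑ c ∈ T, g b' c ^ 2) -
          (∑ c ∈ T, f b c * g b' c) ^ 2)
          (fun b' _ => sub_nonneg.2 (Finset.sum_mul_sq_le_sq_mul_sq _ _ _)) (Finset.mem_univ b)
    _ = _ := by
        simp only [Finset.sum_sub_distrib, ex]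
        rw [← Finset.sum_mul_sum, ef, eg]
        ring

theorem sum_area_le_of_factor_blocks {B : Type*} [Fintype B] {d : ℕ} (hB : Fintype.card B = d)
    (S : Finset ι) (T : Finset κ) (f g : B → ι → κ → ℝ) (R : ι → κ → κ → ℝ)
    (e : ι → ℝ) {F G H : ℝ}
    (hf : ∀ s ∈ S, ∀ c ∈ T, ∀ c' ∈ T, ∑ b, f b s c * f b s c' = F * R s c c')
    (hfg : ∀ s ∈ S, ∀ c ∈ T, ∀ c' ∈ T, ∑ b, f b s c * g b s c' = G * R s c c')
    (hg : ∀ s ∈ S, ∀ c ∈ T, ∀ c' ∈ T, ∑ b, g b s c * g b s c' = H * R s c c')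
    (hR : ∀ s c c', R s c c' = R s c' c) (hR0 : ∀ s, 0 ≤ ∑ c ∈ T, R s c c)
    (hR1 : ∑ s ∈ S, ∑ c ∈ T, R s c c = 1)
    (he : ∀ s ∈ S, e s = ∑ c ∈ T, R s c c -
      (∑ c ∈ T, ∑ c' ∈ T, R s c c' ^ 2) / ∑ c ∈ T, R s c c)
    (he0 : ∀ s, 0 ≤ e s)
    (hRz : ∀ s ∈ S, ∑ c ∈ T, R s c c = 0 → ∑ c ∈ T, ∑ c' ∈ T, R s c c' ^ 2 = 0)
    (hF : 0 ≤ F) (hH : 0 ≤ H) (hG : G ^ 2 ≤ F * H) :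
    ∑ b, ∑ s ∈ S, area T (f b s) (g b s) ≤ √(d * ∑ s ∈ S, e s) * √(F * H - G ^ 2) := by
  rw [Finset.sum_comm]
  have hsq : ∀ s ∈ S, √((∑ c ∈ T, R s c c) ^ 2 - ∑ c ∈ T, ∑ c' ∈ T, R s c c' ^ 2) =
      √(∑ c ∈ T, R s c c) * √(e s) := by
    intro s hs
    rw [← Real.sqrt_mul (hR0 s), he s hs]
    congr 1
    by_cases h0 : ∑ c ∈ T, R s c c = 0
    · simp [h0, hRz s hs h0]
    · field_simp
  have main : ∀ (g' : B → ι → κ → ℝ) (H' : ℝ), 0 ≤ H' →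
      (∀ s ∈ S, ∀ c ∈ T, ∀ c' ∈ T, ∑ b, g' b s c * g' b s c' = H' * R s c c') →
      ∑ s ∈ S, ∑ b, area T (f b s) (g' b s) ≤ √(d * ∑ s ∈ S, e s) * √(F * H') := by
    intro g' H' hH' hg'
    calc _ ≤ ∑ s ∈ S, √(F * H') * √d * (√(∑ c ∈ T, R s c c) * √(e s)) := by
          refine Finset.sum_le_sum fun s hs => ?_
          rw [← hsq s hs]
          exact sum_area_le_of_factor hB T (fun b => f b s) (fun b => g' b s) (R s) hF hH'
            (hf s hs) (hg' s hs)
      _ = √(F * H') * √d * ∑ s ∈ S, √(∑ c ∈ T, R s c c) * √(e s) := by rw [Finset.mul_sum]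
      _ ≤ √(F * H') * √d * √(∑ s ∈ S, e s) := by
          refine mul_le_mul_of_nonneg_left ?_ (by positivity)
          have := Real.sum_sqrt_mul_sqrt_le S hR0 he0
          rwa [hR1, Real.sqrt_one, one_mul] at this
      _ = _ := by rw [Real.sqrt_mul (Nat.cast_nonneg d)]; ring
  rcases hF.eq_or_lt with h0 | h0
  · have hG0 : G ^ 2 = 0 := le_antisymm (by simpa [← h0] using hG) (sq_nonneg _)
    rw [hG0, sub_zero]
    exact main g H hH hg
  · have hFH : F * (H - G ^ 2 / F) = F * H - G ^ 2 := by field_simp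
    have h1 := main (fun b s c => g b s c - G / F * f b s c) (H - G ^ 2 / F)
      (by rw [sub_nonneg, div_le_iff₀ h0]; linarith)
      (fun s hs c hc c' hc' => by
        have e1 : ∀ b, (g b s c - G / F * f b s c) * (g b s c' - G / F * f b s c') =
            g b s c * g b s c' - G / F * (f b s c * g b s c') - G / F * (f b s c' * g b s c) +
              (G / F) ^ 2 * (f b s c * f b s c') := fun b => by ring
        simp only [e1, Finset.sum_add_distrib, Finset.sum_sub_distrib, ← Finset.mul_sum,
          hf s hs c hc c' hc', hg s hs c hc c' hc', hfg s hs c hc c' hc', hfg s hs c' hc' c hc,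
          hR s c' c]
        field_simp
        ring)
    simp only [area_shear] at h1
    rwa [hFH] at h1

end area

section chain

variable {d L : ℕ} {ψ : List (Fin d) → ℝ}

theorem area_words_add (n p : ℕ) (f g : List (Fin d) → ℝ) :
    area (words d (n + p)) f g =
      √((∑ s ∈ words d n, ∑ c ∈ words d p, f (s ++ c) ^ 2) *
        (∑ s ∈ words d n, ∑ c ∈ words d p, g (s ++ c) ^ 2) -
        (∑ s ∈ words d n, ∑ c ∈ words d p, f (s ++ c) * g (s ++ c)) ^ 2) := by
  unfold area
  simp only [sum_words_add]

theorem sum_area_words_le (n p : ℕ) (f g : List (Fin d) → ℝ) :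
    ∑ s ∈ words d n, area (words d p) (fun c => f (s ++ c)) (fun c => g (s ++ c)) ≤
      area (words d (n + p)) f g := by
  rw [area_words_add]
  exact sum_area_le (words d n) (words d p) (fun s c => f (s ++ c)) (fun s c => g (s ++ c))

theorem WordState.sum_area_contract (hψ : WordState d L ψ) {m n p : ℕ} (h : m + (n + 1) + p = L)
    {a a' : List (Fin d)} (ha : a ∈ words d m) (ha' : a' ∈ words d m) :
    ∑ s ∈ words d (n + 1), area (words d p) (fun c => ψ (a ++ (s ++ c)))
        (fun c => ψ (a' ++ (s ++ c))) ≤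
      √(d * avgLinEnt ψ (m + 1) n p) *
        area (words d (n + 1 + p)) (fun w => ψ (a ++ w)) (fun w => ψ (a' ++ w)) := by
  rw [sum_words_cons]
  have hsp := fun (x y : List (Fin d)) (hx : x ∈ words d m) (hy : y ∈ words d m)
      (s : List (Fin d)) (hs : s ∈ words d n) (c : List (Fin d)) (hc : c ∈ words d p)
      (c' : List (Fin d)) (hc' : c' ∈ words d p) =>
    hψ.split m (n + p) (by omega) x hx y hy _ (append_mem_words hs hc)
      _ (append_mem_words hs hc')
  have hfr : ∀ s, frobSq (segMat ψ (m + 1) p s) =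
      ∑ c ∈ words d p, ∑ w ∈ words d (m + 1), ψ (w ++ (s ++ c)) * ψ (w ++ (s ++ c)) := by
    intro s
    rw [frobSq_segMat, Finset.sum_comm]
    simp only [pow_two]
  have hgr : ∀ s, gramSq (segMat ψ (m + 1) p s) =
      ∑ c ∈ words d p, ∑ c' ∈ words d p,
        (∑ w ∈ words d (m + 1), ψ (w ++ (s ++ c)) * ψ (w ++ (s ++ c'))) ^ 2 := by
    intro s
    rw [← gramSq_swap, gramSq, ← Finset.sum_coe_sort (words d p)]
    refine Finset.sum_congr rfl fun c _ => ?_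
    rw [← Finset.sum_coe_sort (words d p)]
    refine Finset.sum_congr rfl fun c' _ => ?_
    rw [← Finset.sum_coe_sort (words d (m + 1))]
    rfl
  have key := sum_area_le_of_factor_blocks (Fintype.card_fin d) (words d n) (words d p)
    (fun b s c => ψ (a ++ b :: (s ++ c))) (fun b s c => ψ (a' ++ b :: (s ++ c)))
    (fun s c c' => ∑ w ∈ words d (m + 1), ψ (w ++ (s ++ c)) * ψ (w ++ (s ++ c')))
    (fun s => linEnt (segMat ψ (m + 1) p s))
    (hsp a a ha ha) (hsp a a' ha ha') (hsp a' a' ha' ha')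
    (fun s c c' => Finset.sum_congr rfl fun _ _ => mul_comm _ _)
    (fun s => Finset.sum_nonneg fun _ _ => Finset.sum_nonneg fun _ _ => mul_self_nonneg _)
    (by
      simp only [← hfr]
      exact hψ.sum_frobSq (by omega))
    (fun s _ => by rw [← hfr, ← hgr]; rfl)
    (fun s => linEnt_nonneg _)
    (fun s _ h0 => by
      rw [← hfr] at h0
      rw [← hgr]
      exact le_antisymm (by simpa [h0] using gramSq_le (segMat ψ (m + 1) p s)) (gramSq_nonneg _))
    (Finset.sum_nonneg fun _ _ => mul_self_nonneg _)
    (Finset.sum_nonneg fun _ _ => mul_self_nonneg _)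
    (by
      simp only [← pow_two]
      exact Finset.sum_mul_sq_le_sq_mul_sq _ _ _)
  refine key.trans (le_of_eq ?_)
  unfold avgLinEnt area
  rw [show n + 1 + p = n + p + 1 by ring]
  simp only [pow_two]

theorem WordState.sum_area_iterate {n : ℕ} (hd : 1 ≤ d)
    (hψ : WordState d L ψ) {p r : ℕ}
    (hn : ∀ {m p : ℕ}, m + 1 + n + p = L → avgLinEnt ψ (m + 1) n p ≤ 1 / (4 * d)) (q : ℕ) :
    ∀ {m : ℕ}, m + ((n + 1) * q + r) + p = L →
    ∀ a ∈ words d m, ∀ a' ∈ words d m,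
    ∑ s ∈ words d ((n + 1) * q + r), area (words d p) (fun c => ψ (a ++ (s ++ c)))
        (fun c => ψ (a' ++ (s ++ c))) ≤
      (1 / 2) ^ q * area (words d ((n + 1) * q + r + p)) (fun w => ψ (a ++ w))
        (fun w => ψ (a' ++ w)) := by
  induction q with
  | zero =>
    intro m h a ha a' ha'
    rw [pow_zero, one_mul]
    exact sum_area_words_le _ _ (fun w => ψ (a ++ w)) (fun w => ψ (a' ++ w))
  | succ q ih =>
    intro m h a ha a' ha'
    have e : (n + 1) * (q + 1) + r = (n + 1) + ((n + 1) * q + r) := by ring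
    rw [e] at h ⊢
    have hd' : (0 : ℝ) < d := by exact_mod_cast hd
    have hle : √(d * avgLinEnt ψ (m + 1) n ((n + 1) * q + r + p)) ≤ 1 / 2 := by
      rw [Real.sqrt_le_left (by norm_num)]
      have := hn (m := m) (p := (n + 1) * q + r + p) (by omega)
      calc _ ≤ d * (1 / (4 * d) : ℝ) := by gcongr
        _ = _ := by field_simp; norm_num
    rw [sum_words_add]
    calc _ ≤ ∑ s ∈ words d (n + 1), (1 / 2) ^ q * area (words d ((n + 1) * q + r + p))
            (fun w => ψ (a ++ (s ++ w))) (fun w => ψ (a' ++ (s ++ w))) := by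
          refine Finset.sum_le_sum fun s hs => ?_
          have := ih (m := m + (n + 1)) (by omega) _ (append_mem_words ha hs)
            _ (append_mem_words ha' hs)
          simpa only [List.append_assoc] using this
      _ = (1 / 2) ^ q * ∑ s ∈ words d (n + 1), area (words d ((n + 1) * q + r + p))
            (fun w => ψ (a ++ (s ++ w))) (fun w => ψ (a' ++ (s ++ w))) := by rw [Finset.mul_sum]
      _ ≤ (1 / 2) ^ q * (1 / 2 * area (words d (n + 1 + ((n + 1) * q + r + p)))
            (fun w => ψ (a ++ w)) (fun w => ψ (a' ++ w))) := by
          refine mul_le_mul_of_nonneg_left ?_ (by positivity)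
          refine (hψ.sum_area_contract (by omega) ha ha').trans ?_
          exact mul_le_mul_of_nonneg_right hle (area_nonneg _ _ _)
      _ = _ := by rw [pow_succ, mul_assoc, add_assoc (n + 1)]

theorem WordState.sum_sqrt_le {n₀ : ℕ} (hψ : WordState d L ψ)
    (hn : ∀ {m p : ℕ}, m + 1 + n₀ + p = L → avgLinEnt ψ (m + 1) n₀ p ≤ 1 / (4 * d))
    {m n p : ℕ} (h : m + 1 + n + p = L) :
    ∑ s ∈ words d n, √(frobSq (segMat ψ (m + 1) p s) ^ 2 - gramSq (segMat ψ (m + 1) p s)) ≤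
      d * (1 / 2) ^ (n / (n₀ + 1)) := by
  have hd : 1 ≤ d := hψ.pos_d h
  obtain ⟨a, ha, hF, hHH⟩ := hψ.exists_row_factor h
  set F := ∑ w ∈ words d (n + p + 1), ψ (a ++ w) * ψ (a ++ w) with hFd
  set H : List (Fin d) → Fin d → words d p → ℝ := fun s b c => ψ (a ++ b :: (s ++ c)) with hH
  have hf : ∀ s ∈ words d n, frobSq (H s) = F * frobSq (segMat ψ (m + 1) p s) := by
    intro s hs
    rw [← frobSq_swap (H s), ← frobSq_swap (segMat ψ (m + 1) p s)]
    simp only [frobSq, pow_two, hH, hHH s hs, Finset.mul_sum]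
  have hg : ∀ s ∈ words d n, gramSq (H s) = F ^ 2 * gramSq (segMat ψ (m + 1) p s) := by
    intro s hs
    rw [← gramSq_swap (H s), ← gramSq_swap (segMat ψ (m + 1) p s)]
    simp only [gramSq, hH, hHH s hs, ← Finset.mul_sum, mul_pow]
  have h1 : ∀ s ∈ words d n,
      F * √(frobSq (segMat ψ (m + 1) p s) ^ 2 - gramSq (segMat ψ (m + 1) p s)) ≤
        ∑ b : Fin d, ∑ b' : Fin d, area (words d p) (fun c => ψ (a ++ [b] ++ (s ++ c)))
          (fun c => ψ (a ++ [b'] ++ (s ++ c))) := by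
    intro s hs
    have e : F * √(frobSq (segMat ψ (m + 1) p s) ^ 2 - gramSq (segMat ψ (m + 1) p s)) =
        √(frobSq (H s) ^ 2 - gramSq (H s)) := by
      rw [hf s hs, hg s hs, mul_pow, ← mul_sub, Real.sqrt_mul (by positivity),
        Real.sqrt_sq hF.le]
    have e2 : frobSq (H s) ^ 2 - gramSq (H s) = ∑ b : Fin d, ∑ b' : Fin d,
        area (words d p) (fun c => ψ (a ++ [b] ++ (s ++ c)))
          (fun c => ψ (a ++ [b'] ++ (s ++ c))) ^ 2 := by
      simp only [area_sq, Finset.sum_sub_distrib, frobSq, gramSq]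
      rw [pow_two, Finset.sum_mul_sum]
      simp only [← Finset.sum_coe_sort (words d p), hH, List.append_assoc, List.singleton_append]
    rw [e, e2, Real.sqrt_le_left (Finset.sum_nonneg fun _ _ => Finset.sum_nonneg fun _ _ =>
      area_nonneg _ _ _)]
    simp only [← Finset.sum_product']
    exact Finset.sum_sq_le_sq_sum_of_nonneg fun _ _ => area_nonneg _ _ _
  have hrow : ∀ b : Fin d, a ++ [b] ∈ words d (m + 1) := fun b => by
    have := mem_words.1 ha
    rw [mem_words]; simp [this]
  have hq : (n₀ + 1) * (n / (n₀ + 1)) + n % (n₀ + 1) = n := Nat.div_add_mod _ _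
  have h2 : ∀ b b' : Fin d, ∑ s ∈ words d n, area (words d p)
      (fun c => ψ (a ++ [b] ++ (s ++ c))) (fun c => ψ (a ++ [b'] ++ (s ++ c))) ≤
      (1 / 2) ^ (n / (n₀ + 1)) * (√(∑ w ∈ words d (n + p), ψ (a ++ [b] ++ w) ^ 2) *
        √(∑ w ∈ words d (n + p), ψ (a ++ [b'] ++ w) ^ 2)) := by
    intro b b'
    have := hψ.sum_area_iterate hd (r := n % (n₀ + 1)) (p := p) hn (n / (n₀ + 1)) (m := m + 1)
      (by rw [hq]; omega) _ (hrow b) _ (hrow b')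
    rw [hq] at this
    exact this.trans (mul_le_mul_of_nonneg_left (area_le _ _ _) (by positivity))
  have h3 : (∑ b : Fin d, √(∑ w ∈ words d (n + p), ψ (a ++ [b] ++ w) ^ 2)) ^ 2 ≤ d * F := by
    have := sq_sum_le_card_mul_sum_sq (s := Finset.univ)
      (f := fun b : Fin d => √(∑ w ∈ words d (n + p), ψ (a ++ [b] ++ w) ^ 2))
    rw [Finset.card_univ, Fintype.card_fin] at this
    refine this.trans (le_of_eq ?_)
    congr 1
    rw [hFd, sum_words_cons]
    refine Finset.sum_congr rfl fun b _ => ?_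
    rw [Real.sq_sqrt (Finset.sum_nonneg fun _ _ => sq_nonneg _)]
    simp only [List.append_assoc, List.singleton_append, pow_two]
  have h4 : F * ∑ s ∈ words d n,
      √(frobSq (segMat ψ (m + 1) p s) ^ 2 - gramSq (segMat ψ (m + 1) p s)) ≤
      (1 / 2) ^ (n / (n₀ + 1)) * (d * F) := by
    rw [Finset.mul_sum]
    refine (Finset.sum_le_sum h1).trans ?_
    rw [Finset.sum_comm]
    calc _ = ∑ b : Fin d, ∑ b' : Fin d, ∑ s ∈ words d n, area (words d p)
          (fun c => ψ (a ++ [b] ++ (s ++ c))) (fun c => ψ (a ++ [b'] ++ (s ++ c))) :=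
          Finset.sum_congr rfl fun _ _ => Finset.sum_comm
      _ ≤ ∑ b : Fin d, ∑ b' : Fin d, (1 / 2) ^ (n / (n₀ + 1)) *
          (√(∑ w ∈ words d (n + p), ψ (a ++ [b] ++ w) ^ 2) *
          √(∑ w ∈ words d (n + p), ψ (a ++ [b'] ++ w) ^ 2)) :=
          Finset.sum_le_sum fun b _ => Finset.sum_le_sum fun b' _ => h2 b b'
      _ = (1 / 2) ^ (n / (n₀ + 1)) *
          (∑ b : Fin d, √(∑ w ∈ words d (n + p), ψ (a ++ [b] ++ w) ^ 2)) ^ 2 := by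
          simp only [← Finset.mul_sum, pow_two, Finset.sum_mul_sum]
      _ ≤ _ := mul_le_mul_of_nonneg_left h3 (by positivity)
  have h5 : F * ∑ s ∈ words d n,
      √(frobSq (segMat ψ (m + 1) p s) ^ 2 - gramSq (segMat ψ (m + 1) p s)) ≤
      F * (d * (1 / 2) ^ (n / (n₀ + 1))) := h4.trans (le_of_eq (by ring))
  exact le_of_mul_le_mul_left h5 hF

end chain

theorem negMulLog_le_two_mul_sqrt {x : ℝ} (h0 : 0 ≤ x) (h1 : x ≤ 1) :
    -(x * Real.log x) ≤ 2 * √(x * (1 - x)) := by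
  rcases h0.eq_or_lt with rfl | h0
  · simp
  have hs : 0 < √x := Real.sqrt_pos.2 h0
  have hs1 : √x ≤ 1 := by rw [Real.sqrt_le_iff]; simpa using h1
  have hsq : √x ^ 2 = x := Real.sq_sqrt h0.le
  have hlog : Real.log x = 2 * Real.log √x := by
    rw [Real.log_sqrt h0.le]; ring
  have hl := Real.one_sub_inv_le_log_of_pos hs
  have h2 : -(x * Real.log x) ≤ 2 * (√x * (1 - √x)) := by
    rw [hlog]
    have e : x * (1 - (√x)⁻¹) = x - √x := by
      nth_rewrite 1 [← hsq]
      nth_rewrite 3 [← hsq]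
      field_simp
    nlinarith [mul_le_mul_of_nonneg_left hl h0.le]
  refine h2.trans (mul_le_mul_of_nonneg_left ?_ zero_le_two)
  rw [Real.sqrt_mul h0.le]
  refine mul_le_mul_of_nonneg_left (Real.le_sqrt_of_sq_le ?_) hs.le
  nlinarith

theorem mul_log_ge {d y : ℝ} (hd : 1 ≤ d) (h0 : 0 < y) (h1 : y ≤ d) :
    (y - 1) + (y - 1) ^ 2 / (4 * d) ≤ y * Real.log y := by
  have hs : 0 < √y := Real.sqrt_pos.2 h0
  have hsq : √y ^ 2 = y := Real.sq_sqrt h0.le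
  have hlog : Real.log y = 2 * Real.log √y := by
    rw [Real.log_sqrt h0.le]; ring
  have hl := Real.one_sub_inv_le_log_of_pos hs
  have h2 : 2 * (y - √y) ≤ y * Real.log y := by
    rw [hlog]
    have e : y * (1 - (√y)⁻¹) = y - √y := by
      nth_rewrite 1 [← hsq]
      nth_rewrite 3 [← hsq]
      field_simp
    nlinarith [mul_le_mul_of_nonneg_left hl h0.le]
  refine le_trans ?_ h2
  rw [← le_sub_iff_add_le', div_le_iff₀ (by linarith)]
  generalize √y = s at *
  subst hsq
  have h3 : (s + 1) ^ 2 ≤ 4 * d := by nlinarith [sq_nonneg (s - 1)]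
  calc (s ^ 2 - 1) ^ 2 = (s - 1) ^ 2 * (s + 1) ^ 2 := by ring
    _ ≤ (s - 1) ^ 2 * (4 * d) := mul_le_mul_of_nonneg_left h3 (sq_nonneg _)
    _ = _ := by ring

section spectra

variable {ι : Type*} [Fintype ι] {l : ι → ℝ} {d : ℕ}

theorem shannon_le_sqrt (h0 : ∀ i, 0 ≤ l i) (h1 : ∑ i, l i = 1)
    (hd : (Finset.univ.filter fun i => l i ≠ 0).card ≤ d) :
    -∑ i, l i * Real.log (l i) ≤ 2 * √(d * (1 - ∑ i, l i ^ 2)) := by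
  have hle : ∀ i, l i ≤ 1 := fun i => by
    rw [← h1]; exact Finset.single_le_sum (fun i _ => h0 i) (Finset.mem_univ i)
  have hn : ∀ i, 0 ≤ l i * (1 - l i) := fun i => mul_nonneg (h0 i) (sub_nonneg.2 (hle i))
  rw [← Finset.sum_neg_distrib]
  refine (Finset.sum_le_sum fun i _ => negMulLog_le_two_mul_sqrt (h0 i) (hle i)).trans ?_
  rw [← Finset.mul_sum]
  refine mul_le_mul_of_nonneg_left (Real.le_sqrt_of_sq_le ?_) zero_le_two
  have e : ∑ i, √(l i * (1 - l i)) =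
      ∑ i ∈ Finset.univ.filter fun i => l i ≠ 0, √(l i * (1 - l i)) := by
    rw [Finset.sum_filter]
    refine Finset.sum_congr rfl fun i _ => ?_
    by_cases h : l i = 0 <;> simp [h]
  rw [e]
  refine sq_sum_le_card_mul_sum_sq.trans ?_
  have e2 : 1 - ∑ i, l i ^ 2 = ∑ i, l i * (1 - l i) := by
    simp only [mul_sub, mul_one, Finset.sum_sub_distrib, h1, pow_two]
  rw [e2]
  refine mul_le_mul (by exact_mod_cast hd) ?_ (Finset.sum_nonneg fun _ _ => sq_nonneg _)
    (by positivity)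
  simp only [Real.sq_sqrt (hn _)]
  exact Finset.sum_le_sum_of_subset_of_nonneg (Finset.filter_subset _ _) fun i _ _ => hn i

theorem shannon_le_log_sub (hd1 : 1 ≤ d) (h0 : ∀ i, 0 ≤ l i) (h1 : ∑ i, l i = 1)
    (hd : (Finset.univ.filter fun i => l i ≠ 0).card ≤ d) :
    -∑ i, l i * Real.log (l i) ≤ Real.log d - (∑ i, l i ^ 2 - 1 / d) / 4 := by
  have hle : ∀ i, l i ≤ 1 := fun i => by
    rw [← h1]; exact Finset.single_le_sum (fun i _ => h0 i) (Finset.mem_univ i)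
  have hd' : (1 : ℝ) ≤ d := by exact_mod_cast hd1
  have hd0 : (0 : ℝ) < d := by linarith
  set N := Finset.univ.filter fun i => l i ≠ 0 with hN
  have hpos : ∀ i ∈ N, 0 < l i := fun i hi =>
    lt_of_le_of_ne (h0 i) (Ne.symm (by simpa [hN] using hi))
  have hsumN : ∀ F : ℝ → ℝ, F 0 = 0 → ∑ i ∈ N, F (l i) = ∑ i, F (l i) := by
    intro F hF
    rw [hN, Finset.sum_filter]
    refine Finset.sum_congr rfl fun i _ => ?_
    by_cases h : l i = 0 <;> simp [h, hF]
  have key := Finset.sum_le_sum fun i hi => mul_log_ge (y := d * l i) hd'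
    (mul_pos hd0 (hpos i hi)) (by nlinarith [hle i])
  have e1 : ∑ i ∈ N, d * l i * Real.log (d * l i) =
      d * (Real.log d + ∑ i, l i * Real.log (l i)) := by
    have : ∀ i ∈ N, d * l i * Real.log (d * l i) =
        d * (Real.log d * l i + l i * Real.log (l i)) := by
      intro i hi
      rw [Real.log_mul hd0.ne' (hpos i hi).ne']; ring
    rw [Finset.sum_congr rfl this, ← Finset.mul_sum, Finset.sum_add_distrib, ← Finset.mul_sum,
      hsumN (fun x => x) rfl, hsumN (fun x => x * Real.log x) (by simp), h1, mul_one]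
  have e2 : ∑ i ∈ N, ((d * l i - 1) + (d * l i - 1) ^ 2 / (4 * d)) =
      (d - N.card) + (d ^ 2 * ∑ i, l i ^ 2 - 2 * d + N.card) / (4 * d) := by
    rw [Finset.sum_add_distrib, ← Finset.sum_div]
    congr 1
    · rw [Finset.sum_sub_distrib, ← Finset.mul_sum, hsumN (fun x => x) rfl, h1]
      simp
    · congr 1
      have : ∀ i, (d * l i - 1) ^ 2 = d ^ 2 * l i ^ 2 - 2 * d * l i + 1 := fun i => by ring
      simp only [this, Finset.sum_add_distrib, Finset.sum_sub_distrib, ← Finset.mul_sum,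
        hsumN (fun x => x) rfl, hsumN (fun x => x ^ 2) (by simp), h1]
      simp
  rw [e1, e2] at key
  have hr : (N.card : ℝ) ≤ d := by exact_mod_cast hd
  set T := ∑ i, l i ^ 2
  set S := ∑ i, l i * Real.log (l i)
  set r := (N.card : ℝ)
  have e3 : (d * T - 1) / 4 ≤ (d - r) + (d ^ 2 * T - 2 * d + r) / (4 * d) := by
    have : (d - r) + (d ^ 2 * T - 2 * d + r) / (4 * d) =
        (d * T - 1) / 4 + (d - r) * ((4 * d - 1) / (4 * d)) := by field_simp; ring
    rw [this]
    exact le_add_of_nonneg_right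
      (mul_nonneg (by linarith) (div_nonneg (by linarith) (by linarith)))
  have e4 : d * ((T - 1 / d) / 4) = (d * T - 1) / 4 := by field_simp
  have e5 : d * ((T - 1 / d) / 4) ≤ d * (Real.log d + S) := by rw [e4]; exact e3.trans key
  have := le_of_mul_le_mul_left e5 hd0
  linarith

end spectra

theorem Matrix.IsHermitian.trace_mul_self_eq {n : Type*} [Fintype n] [DecidableEq n]
    {ρ : Matrix n n ℂ} (h : ρ.IsHermitian) :
    (ρ * ρ).trace = ((∑ i, h.eigenvalues i ^ 2 : ℝ) : ℂ) := by
  have hs := h.spectral_theorem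
  nth_rewrite 1 2 [hs]
  rw [← map_mul, Unitary.conjStarAlgAut_apply, Matrix.trace_mul_cycle, Unitary.coe_star_mul_self,
    one_mul, Matrix.diagonal_mul_diagonal, Matrix.trace_diagonal]
  simp [pow_two]

open scoped ComplexOrder in
/-- Spectral data of the reduced state of a real bipartite amplitude matrix `X` whose right Gram
matrix is proportional to that of a matrix with few rows. -/
theorem eigenvalues_of_amplitudes {n C K : Type*} [Fintype n] [DecidableEq n] [Fintype C]
    [Fintype K] {ρ : Matrix n n ℂ} {X : n → C → ℝ} {Y : K → C → ℝ} {F : ℝ} (hF : 0 < F)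
    (hX : 0 < frobSq X)
    (hρ : ∀ τ τ', ρ τ τ' = (((∑ c, X τ c * X τ' c) / frobSq X : ℝ) : ℂ))
    (hY : ∀ c c', ∑ b, Y b c * Y b c' = F * ∑ τ, X τ c * X τ c') :
    ∃ h : ρ.IsHermitian, (∀ i, 0 ≤ h.eigenvalues i) ∧ ∑ i, h.eigenvalues i = 1 ∧
      ∑ i, h.eigenvalues i ^ 2 = gramSq X / frobSq X ^ 2 ∧
      (Finset.univ.filter fun i => h.eigenvalues i ≠ 0).card ≤ Fintype.card K := by
  set p := frobSq X with hp
  have hsp : √p * √p = p := Real.mul_self_sqrt hX.le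
  set Z : Matrix n C ℂ := Matrix.of fun τ c => ((X τ c / √p : ℝ) : ℂ) with hZ
  set W : Matrix K C ℂ := Matrix.of fun b c => ((Y b c / √(F * p) : ℝ) : ℂ) with hW
  have hρZ : ρ = Z * Z.conjTranspose := by
    ext τ τ'
    rw [hρ, Matrix.mul_apply, Finset.sum_div, Complex.ofReal_sum]
    refine Finset.sum_congr rfl fun c _ => ?_
    simp only [hZ, Matrix.conjTranspose_apply, Matrix.of_apply, Complex.star_def,
      Complex.conj_ofReal]
    rw [← Complex.ofReal_mul, div_mul_div_comm, hsp]
  have hpsd : ρ.PosSemidef := hρZ ▸ Matrix.posSemidef_self_mul_conjTranspose Z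
  have hZW : Z.conjTranspose * Z = W.conjTranspose * W := by
    ext c c'
    simp only [hZ, hW, Matrix.mul_apply, Matrix.conjTranspose_apply, Matrix.of_apply,
      Complex.star_def, Complex.conj_ofReal, ← Complex.ofReal_mul, ← Complex.ofReal_sum,
      div_mul_div_comm, ← Finset.sum_div, hsp, hY]
    rw [Real.mul_self_sqrt (by positivity), mul_div_mul_left _ _ hF.ne']
  have h := hpsd.isHermitian
  refine ⟨h, hpsd.eigenvalues_nonneg, ?_, ?_, ?_⟩
  · have ht := h.trace_eq_sum_eigenvalues
    have : ρ.trace = ((1 : ℝ) : ℂ) := by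
      simp only [Matrix.trace, Matrix.diag_apply, hρ, ← Complex.ofReal_sum]
      rw [← Finset.sum_div]
      simp only [← pow_two]
      congr 1
      exact div_self hX.ne'
    rw [this] at ht
    have h2 : ((∑ i, h.eigenvalues i : ℝ) : ℂ) = ((1 : ℝ) : ℂ) := by
      rw [ht]; push_cast; rfl
    exact_mod_cast h2
  · have ht := h.trace_mul_self_eq
    have : (ρ * ρ).trace = ((gramSq X / p ^ 2 : ℝ) : ℂ) := by
      simp only [Matrix.trace, Matrix.diag_apply, Matrix.mul_apply, hρ, ← Complex.ofReal_mul,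
        ← Complex.ofReal_sum]
      congr 1
      rw [gramSq, Finset.sum_div]
      refine Finset.sum_congr rfl fun a _ => ?_
      rw [Finset.sum_div]
      refine Finset.sum_congr rfl fun a' _ => ?_
      rw [div_mul_div_comm, pow_two, pow_two]
      congr 2
      exact Finset.sum_congr rfl fun _ _ => mul_comm _ _
    rw [this] at ht
    exact_mod_cast ht.symm
  · have hr : ρ.rank ≤ Fintype.card K := by
      rw [hρZ, Matrix.rank_self_mul_conjTranspose, ← Matrix.rank_conjTranspose_mul_self, hZW,
        Matrix.rank_conjTranspose_mul_self]
      exact Matrix.rank_le_card_height W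
    rw [h.rank_eq_card_non_zero_eigs, Fintype.card_subtype] at hr
    convert hr

theorem frobSq_mul_vnEntropy_le {n C K : Type*} [Fintype n] [DecidableEq n] [Fintype C]
    [Fintype K] {ρ : Matrix n n ℂ} {X : n → C → ℝ} {Y : K → C → ℝ} {F : ℝ} (hF : 0 < F)
    (hX : 0 < frobSq X)
    (hρ : ∀ τ τ', ρ τ τ' = (((∑ c, X τ c * X τ' c) / frobSq X : ℝ) : ℂ))
    (hY : ∀ c c', ∑ b, Y b c * Y b c' = F * ∑ τ, X τ c * X τ c')
    {d : ℕ} (hd : 1 ≤ d) (hK : Fintype.card K = d) :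
    frobSq X * vnEntropy ρ ≤ 2 * √d * √(frobSq X ^ 2 - gramSq X) ∧
      frobSq X * vnEntropy ρ ≤
        frobSq X * Real.log d - (frobSq X * (1 - 1 / d) - linEnt X) / 4 := by
  obtain ⟨h, h0, h1, h2, h3⟩ := eigenvalues_of_amplitudes hF hX hρ hY
  rw [hK] at h3
  have hS : vnEntropy ρ = -∑ a, h.eigenvalues a * Real.log (h.eigenvalues a) := by
    rw [vnEntropy, dif_pos h]
  rw [hS]
  constructor
  · have := mul_le_mul_of_nonneg_left (shannon_le_sqrt h0 h1 h3) hX.le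
    refine this.trans (le_of_eq ?_)
    rw [h2]
    have e : frobSq X ^ 2 - gramSq X = frobSq X ^ 2 * (1 - gramSq X / frobSq X ^ 2) := by
      field_simp
    rw [e, Real.sqrt_mul (by positivity), Real.sqrt_mul (sq_nonneg (frobSq X)),
      Real.sqrt_sq hX.le]
    ring
  · have := mul_le_mul_of_nonneg_left (shannon_le_log_sub hd h0 h1 h3) hX.le
    refine this.trans (le_of_eq ?_)
    rw [h2, linEnt]
    field_simp
    ring

section bridge

variable {d L : ℕ}

/-- Read off the letters of a word at the positions `f x`, with default letter `z`. -/
def readAt (z : Fin d) {α : Type*} (f : α → ℕ) (l : List (Fin d)) : α → Fin d :=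
  fun x => l.getD (f x) z

theorem readAt_bijective (z : Fin d) {α : Type*} {f : α → ℕ} {n : ℕ} (hf : Function.Injective f)
    (hlt : ∀ x, f x < n) (hsurj : ∀ k < n, ∃ x, f x = k) :
    Function.Bijective fun l : words d n => readAt z f l.1 := by
  constructor
  · rintro ⟨l, hl⟩ ⟨l', hl'⟩ h
    rw [mem_words] at hl hl'
    refine Subtype.ext (List.ext_getElem (hl.trans hl'.symm) fun k hk hk' => ?_)
    obtain ⟨x, rfl⟩ := hsurj k (hl ▸ hk)
    have := congrFun h x
    simpa [readAt, hk, hk'] using this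
  · intro τ
    choose g hg using hsurj
    refine ⟨⟨List.ofFn fun k : Fin n => τ (g k.1 k.2), mem_words.2 (by simp)⟩, funext fun x => ?_⟩
    have : g (f x) (hlt x) = x := hf (hg _ _)
    simp [readAt, hlt x, this]

theorem sum_readAt (z : Fin d) {α E : Type*} [AddCommMonoid E] {f : α → ℕ} {n : ℕ}
    (hf : Function.Injective f) (hlt : ∀ x, f x < n) (hsurj : ∀ k < n, ∃ x, f x = k)
    [Fintype (α → Fin d)] (F : (α → Fin d) → E) :
    ∑ τ, F τ = ∑ l ∈ words d n, F (readAt z f l) := by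
  rw [← Finset.sum_coe_sort (words d n)]
  exact ((readAt_bijective z hf hlt hsurj).sum_comp F).symm

/-- The configuration on the sites satisfying `P` that spells `l` from the site `k` on. -/
def block (z : Fin d) (k : ℕ) (P : Fin L → Prop) (l : List (Fin d)) : {x // P x} → Fin d :=
  readAt z (fun x => x.1.1 - k) l

theorem block_bijective (z : Fin d) {k n : ℕ} {P : Fin L → Prop} (h : k + n ≤ L)
    (hP : ∀ x : Fin L, P x ↔ k ≤ x.1 ∧ x.1 < k + n) :
    Function.Bijective fun l : words d n => block z k P l.1 := by
  refine readAt_bijective z ?_ ?_ ?_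
  · rintro ⟨x, hx⟩ ⟨y, hy⟩ hxy
    rw [hP] at hx hy
    simp only [Subtype.mk.injEq, Fin.ext_iff] at hxy ⊢
    omega
  · rintro ⟨x, hx⟩
    rw [hP] at hx
    simp only
    omega
  · intro i hi
    exact ⟨⟨⟨k + i, by omega⟩, (hP _).2 ⟨by simp, by simpa using hi⟩⟩, by simp⟩

theorem sum_block (z : Fin d) {E : Type*} [AddCommMonoid E] {k n : ℕ} {P : Fin L → Prop}
    (h : k + n ≤ L) (hP : ∀ x : Fin L, P x ↔ k ≤ x.1 ∧ x.1 < k + n)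
    [Fintype ({x // P x} → Fin d)] (F : ({x // P x} → Fin d) → E) :
    ∑ τ, F τ = ∑ l ∈ words d n, F (block z k P l) := by
  rw [← Finset.sum_coe_sort (words d n)]
  exact ((block_bijective z h hP).sum_comp F).symm

theorem sum_config (z : Fin d) {E : Type*} [AddCommMonoid E] (F : (Fin L → Fin d) → E) :
    ∑ σ, F σ = ∑ l ∈ words d L, F (readAt z Fin.val l) :=
  sum_readAt z Fin.val_injective (fun x => x.2) (fun k hk => ⟨⟨k, hk⟩, rfl⟩) F

theorem glue_block_left (z : Fin d) {m : ℕ} {R : Finset (Fin L)} (hR : ∀ x, x ∈ R ↔ x.1 < m)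
    {a w : List (Fin d)} (ha : a ∈ words d m) :
    glue R (block z 0 _ a) (block z m _ w) = readAt z Fin.val (a ++ w) := by
  rw [mem_words] at ha
  funext x
  by_cases h : x ∈ R
  · have hx := (hR x).1 h
    rw [glue, dif_pos h, readAt, List.getD_append _ _ _ _ (by omega)]
    simp [block, readAt]
  · have hx := mt (hR x).2 h
    rw [glue, dif_neg h, readAt, List.getD_append_right _ _ _ _ (by omega), ha]
    simp [block, readAt]

theorem glue_block_right (z : Fin d) {m : ℕ} {R : Finset (Fin L)} (hR : ∀ x, x ∈ R ↔ m ≤ x.1)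
    {w c : List (Fin d)} (hw : w ∈ words d m) :
    glue R (block z m _ c) (block z 0 _ w) = readAt z Fin.val (w ++ c) := by
  rw [mem_words] at hw
  funext x
  by_cases h : x ∈ R
  · have hx := (hR x).1 h
    rw [glue, dif_pos h, readAt, List.getD_append_right _ _ _ _ (by omega), hw]
    simp [block, readAt]
  · have hx := mt (hR x).2 h
    rw [glue, dif_neg h, readAt, List.getD_append _ _ _ _ (by omega)]
    simp [block, readAt]

theorem glue_compl_site (z : Fin d) {m : ℕ} {R : Finset (Fin L)} (hR : ∀ x, x ∈ R ↔ x.1 ≠ m)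
    {a c : List (Fin d)} (ha : a ∈ words d m) (b b₀ : Fin d) :
    glue R (block z 0 _ (a ++ b₀ :: c)) (block z m _ [b]) =
      readAt z Fin.val (a ++ b :: c) := by
  rw [mem_words] at ha
  funext x
  by_cases h : x ∈ R
  · have hx := (hR x).1 h
    rw [glue, dif_pos h, readAt]
    simp only [block, readAt, Nat.sub_zero]
    rcases lt_or_gt_of_ne hx with h1 | h1
    · rw [List.getD_append _ _ _ _ (by omega), List.getD_append _ _ _ _ (by omega)]
    · rw [List.getD_append_right _ _ _ _ (by omega), List.getD_append_right _ _ _ _ (by omega)]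
      obtain ⟨k, hk⟩ : ∃ k, x.1 - a.length = k + 1 := ⟨x.1 - a.length - 1, by omega⟩
      rw [hk, List.getD_cons_succ, List.getD_cons_succ]
  · have hx : x.1 = m := by by_contra h'; exact h ((hR x).2 h')
    rw [glue, dif_neg h, readAt, List.getD_append_right _ _ _ _ (by omega)]
    simp [block, readAt, hx, ha]

theorem rhoR_left (z : Fin d) (Ψ : (Fin L → Fin d) → ℂ) {m n : ℕ} (h : m + n = L)
    {R : Finset (Fin L)} (hR : ∀ x, x ∈ R ↔ x.1 < m) {a a' : List (Fin d)}
    (ha : a ∈ words d m) (ha' : a' ∈ words d m) :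
    rhoR Ψ R (block z 0 _ a) (block z 0 _ a') = ∑ w ∈ words d n,
      Ψ (readAt z Fin.val (a ++ w)) * (starRingEnd ℂ) (Ψ (readAt z Fin.val (a' ++ w))) := by
  rw [rhoR, Matrix.of_apply, sum_block z (k := m) (n := n) h.le fun x => by rw [hR]; omega]
  simp only [glue_block_left z hR ha, glue_block_left z hR ha']

theorem rhoR_right (z : Fin d) (Ψ : (Fin L → Fin d) → ℂ) {m : ℕ} (h : m ≤ L)
    {R : Finset (Fin L)} (hR : ∀ x, x ∈ R ↔ m ≤ x.1) (c c' : List (Fin d)) :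
    rhoR Ψ R (block z m _ c) (block z m _ c') = ∑ w ∈ words d m,
      Ψ (readAt z Fin.val (w ++ c)) * (starRingEnd ℂ) (Ψ (readAt z Fin.val (w ++ c'))) := by
  rw [rhoR, Matrix.of_apply, sum_block z (k := 0) (n := m) (by omega)
    fun x => by rw [hR]; omega]
  refine Finset.sum_congr rfl fun w hw => ?_
  rw [glue_block_right z hR hw, glue_block_right z hR hw]

theorem rhoR_compl_site (z : Fin d) (Ψ : (Fin L → Fin d) → ℂ) {m : ℕ} (h : m < L)
    {R : Finset (Fin L)} (hR : ∀ x, x ∈ R ↔ x.1 ≠ m) {a a' : List (Fin d)}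
    (ha : a ∈ words d m) (ha' : a' ∈ words d m) (c c' : List (Fin d)) :
    rhoR Ψ R (block z 0 _ (a ++ z :: c)) (block z 0 _ (a' ++ z :: c')) = ∑ b,
      Ψ (readAt z Fin.val (a ++ b :: c)) *
        (starRingEnd ℂ) (Ψ (readAt z Fin.val (a' ++ b :: c'))) := by
  rw [rhoR, Matrix.of_apply, sum_block z (k := m) (n := 1) h
    fun x => by rw [hR]; omega, ← zero_add 1, sum_words_cons]
  simp only [words_zero, Finset.sum_singleton, glue_compl_site z hR ha, glue_compl_site z hR ha']

/-- The amplitudes of a state as a function of words. -/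
def wordAmp (z : Fin d) (Ψ : (Fin L → Fin d) → ℂ) (l : List (Fin d)) : ℝ :=
  (Ψ (readAt z Fin.val l)).re

variable {Ψ : (Fin L → Fin d) → ℂ}

theorem ofReal_wordAmp (z : Fin d) (h0 : NonNegLine Ψ) (l : List (Fin d)) :
    Ψ (readAt z Fin.val l) = (wordAmp z Ψ l : ℂ) :=
  Complex.ext rfl (by simpa using (h0 _).2)

theorem wordState_wordAmp (z : Fin d) (h1 : NormalizedLine Ψ) (h0 : NonNegLine Ψ)
    (hc : ZeroCorr Ψ) : WordState d L (wordAmp z Ψ) where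
  nonneg l := (h0 _).1
  norm := by
    rw [NormalizedLine, sum_config z] at h1
    rw [← h1]
    refine Finset.sum_congr rfl fun l _ => ?_
    rw [ofReal_wordAmp z h0, Complex.normSq_ofReal, pow_two]
  split m p h a ha a' ha' c hcw c' hcw' := by
    set A : Finset (Fin L) := Finset.univ.filter fun x => x.1 < m with hA
    set B : Finset (Fin L) := Finset.univ.filter fun x => m + 1 ≤ x.1 with hB
    have hAm : ∀ x, x ∈ A ↔ x.1 < m := fun x => by simp [hA]
    have hBm : ∀ x, x ∈ B ↔ m + 1 ≤ x.1 := fun x => by simp [hB]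
    have hAB : ∀ x, x ∈ A ∪ B ↔ x.1 ≠ m := fun x => by
      rw [Finset.mem_union, hAm, hBm]; omega
    have key := hc A B (fun x hx y hy => by
      rw [hAm] at hx
      rw [hBm] at hy
      rw [le_abs]
      omega) (block z 0 _ (a ++ z :: c)) (block z 0 _ (a' ++ z :: c'))
    have eA : ∀ a ∈ words d m, ∀ c : List (Fin d), (fun x : {x // x ∈ A} =>
        block z 0 (fun x => x ∈ A ∪ B) (a ++ z :: c) ⟨x.1, Finset.mem_union_left B x.2⟩) =
        block z 0 _ a := by
      intro a ha c
      rw [mem_words] at ha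
      funext x
      have := (hAm x.1).1 x.2
      simp only [block, readAt]
      rw [List.getD_append _ _ _ _ (by omega)]
    have eB : ∀ a ∈ words d m, ∀ c : List (Fin d), (fun x : {x // x ∈ B} =>
        block z 0 (fun x => x ∈ A ∪ B) (a ++ z :: c) ⟨x.1, Finset.mem_union_right A x.2⟩) =
        block z (m + 1) _ c := by
      intro a ha c
      rw [mem_words] at ha
      funext x
      have := (hBm x.1).1 x.2
      simp only [block, readAt]
      rw [List.getD_append_right _ _ _ _ (by omega)]
      obtain ⟨k, hk⟩ : ∃ k, x.1.1 - 0 - a.length = k + 1 := ⟨x.1.1 - a.length - 1, by omega⟩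
      rw [hk, List.getD_cons_succ]
      congr 1
      omega
    rw [rhoR_compl_site z Ψ (by omega) hAB ha ha', eA a ha, eA a' ha', eB a ha, eB a' ha',
      rhoR_left z Ψ h hAm ha ha', rhoR_right z Ψ (by omega) hBm] at key
    simp only [ofReal_wordAmp z h0, Complex.conj_ofReal] at key
    exact_mod_cast key

end bridge

section measurement

variable {d L : ℕ} {Ψ : (Fin L → Fin d) → ℂ} {M : Finset (Fin L)} {m n p : ℕ}

theorem readAt_eq_block_iff (z : Fin d) (h : m + n + p = L)
    (hM : ∀ x, x ∈ M ↔ m ≤ x.1 ∧ x.1 < m + n) {a s s' c : List (Fin d)} (ha : a ∈ words d m)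
    (hs : s ∈ words d n) (hs' : s' ∈ words d n) :
    (∀ k : {x // x ∈ M}, readAt z Fin.val (a ++ (s' ++ c)) k.1 = block z m _ s k) ↔ s' = s := by
  have e : (fun k : {x // x ∈ M} => readAt z Fin.val (a ++ (s' ++ c)) k.1) = block z m _ s' := by
    rw [mem_words] at ha hs'
    funext k
    have hk := (hM k.1).1 k.2
    simp only [block, readAt]
    rw [List.getD_append_right _ _ _ _ (by omega), List.getD_append _ _ _ _ (by omega), ha]
  rw [← funext_iff (f := fun k : {x // x ∈ M} => readAt z Fin.val (a ++ (s' ++ c)) k.1), e]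
  constructor
  · intro he
    have := (block_bijective z (by omega) hM).1 (a₁ := ⟨s', hs'⟩) (a₂ := ⟨s, hs⟩) he
    simpa using this
  · rintro rfl; rfl

theorem probM_block (z : Fin d) (h0 : NonNegLine Ψ) (h : m + n + p = L)
    (hM : ∀ x, x ∈ M ↔ m ≤ x.1 ∧ x.1 < m + n) {s : List (Fin d)} (hs : s ∈ words d n) :
    probM Ψ M (block z m _ s) = frobSq (segMat (wordAmp z Ψ) m p s) := by
  have hL : words d L = words d (m + (n + p)) := congrArg (words d) (by omega)
  rw [probM, sum_config z, frobSq_segMat, hL, sum_words_add]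
  refine Finset.sum_congr rfl fun a ha => ?_
  rw [sum_words_add, Finset.sum_eq_single_of_mem s hs]
  · refine Finset.sum_congr rfl fun c _ => ?_
    rw [if_pos ((readAt_eq_block_iff z h hM ha hs hs).2 rfl), ofReal_wordAmp z h0,
      Complex.normSq_ofReal, pow_two]
  · intro s' hs' hne
    refine Finset.sum_eq_zero fun c _ => ?_
    rw [if_neg (mt (readAt_eq_block_iff z h hM ha hs hs').1 hne)]

theorem rhoR_postState (z : Fin d) (h0 : NonNegLine Ψ) (h : m + n + p = L)
    (hM : ∀ x, x ∈ M ↔ m ≤ x.1 ∧ x.1 < m + n) {R : Finset (Fin L)}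
    (hR : ∀ x, x ∈ R ↔ x.1 < m) {s : List (Fin d)} (hs : s ∈ words d n) (a a' : words d m) :
    rhoR (postState Ψ M (block z m _ s)) R (block z 0 _ a.1) (block z 0 _ a'.1) =
      (((∑ c, segMat (wordAmp z Ψ) m p s a c * segMat (wordAmp z Ψ) m p s a' c) /
        frobSq (segMat (wordAmp z Ψ) m p s) : ℝ) : ℂ) := by
  have hp : ∀ s' ∈ words d n, ∀ a ∈ words d m, ∀ c : List (Fin d),
      postState Ψ M (block z m _ s) (readAt z Fin.val (a ++ (s' ++ c))) =
        if s' = s then ((wordAmp z Ψ (a ++ (s ++ c)) /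
          √(frobSq (segMat (wordAmp z Ψ) m p s)) : ℝ) : ℂ) else 0 := by
    intro s' hs' a ha c
    simp only [postState, readAt_eq_block_iff z h hM ha hs hs']
    split_ifs with he
    · rw [he, ofReal_wordAmp z h0, probM_block z h0 h hM hs, Complex.ofReal_div]
    · rfl
  rw [rhoR_left z _ (m := m) (n := n + p) (by omega) hR a.2 a'.2, sum_words_add,
    Finset.sum_eq_single_of_mem s hs]
  · rw [Finset.sum_div, Complex.ofReal_sum, ← Finset.sum_coe_sort (words d p)]
    refine Finset.sum_congr rfl fun c _ => ?_
    rw [hp s hs _ a.2, hp s hs _ a'.2, if_pos rfl, if_pos rfl, Complex.conj_ofReal,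
      ← Complex.ofReal_mul, div_mul_div_comm, Real.mul_self_sqrt (frobSq_nonneg _)]
    rfl
  · intro s' hs' hne
    refine Finset.sum_eq_zero fun c _ => ?_
    rw [hp s' hs' _ a.2, if_neg hne, zero_mul]

theorem frobSq_mul_vnEntropy_postState_le (z : Fin d) (h1 : NormalizedLine Ψ)
    (h0 : NonNegLine Ψ) (hc : ZeroCorr Ψ) (h : m + 1 + n + p = L)
    (hM : ∀ x, x ∈ M ↔ m + 1 ≤ x.1 ∧ x.1 < m + 1 + n) {R : Finset (Fin L)}
    (hR : ∀ x, x ∈ R ↔ x.1 < m + 1) {s : List (Fin d)} (hs : s ∈ words d n)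
    (hpos : 0 < frobSq (segMat (wordAmp z Ψ) (m + 1) p s)) :
    frobSq (segMat (wordAmp z Ψ) (m + 1) p s) *
        vnEntropy (rhoR (postState Ψ M (block z (m + 1) _ s)) R) ≤
      2 * √d * √(frobSq (segMat (wordAmp z Ψ) (m + 1) p s) ^ 2 -
        gramSq (segMat (wordAmp z Ψ) (m + 1) p s)) ∧
    frobSq (segMat (wordAmp z Ψ) (m + 1) p s) *
        vnEntropy (rhoR (postState Ψ M (block z (m + 1) _ s)) R) ≤
      frobSq (segMat (wordAmp z Ψ) (m + 1) p s) * Real.log d -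
        (frobSq (segMat (wordAmp z Ψ) (m + 1) p s) * (1 - 1 / d) -
          linEnt (segMat (wordAmp z Ψ) (m + 1) p s)) / 4 := by
  have hψ := wordState_wordAmp z h1 h0 hc
  obtain ⟨a, -, hF, hY⟩ := hψ.exists_row_factor h
  set e := (Equiv.ofBijective _ (block_bijective (P := fun x => x ∈ R) z (k := 0) (n := m + 1)
    (by omega) fun x => by rw [hR]; omega)).symm with he
  set S := segMat (wordAmp z Ψ) (m + 1) p s with hS
  have hf : frobSq (fun τ => S (e τ)) = frobSq S :=
    e.sum_comp fun a => ∑ c, S a c ^ 2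
  have hg : gramSq (fun τ => S (e τ)) = gramSq S := by
    have : ∀ a, ∑ τ', (∑ c, S a c * S (e τ') c) ^ 2 = ∑ a', (∑ c, S a c * S a' c) ^ 2 :=
      fun a => e.sum_comp fun a' => (∑ c, S a c * S a' c) ^ 2
    simp only [gramSq, this]
    exact e.sum_comp fun a => ∑ a', (∑ c, S a c * S a' c) ^ 2
  have hl : linEnt (fun τ => S (e τ)) = linEnt S := by rw [linEnt, linEnt, hf, hg]
  rw [← hl, ← hg, ← hf]
  refine frobSq_mul_vnEntropy_le (Y := fun b (c : words d p) => wordAmp z Ψ (a ++ b :: (s ++ c.1)))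
    hF (by rwa [hf]) ?_ ?_ (hψ.pos_d h) (Fintype.card_fin d)
  · intro τ τ'
    rw [hf]
    obtain ⟨u, rfl⟩ := e.symm.surjective τ
    obtain ⟨u', rfl⟩ := e.symm.surjective τ'
    simp only [Equiv.apply_symm_apply]
    exact rhoR_postState z h0 h hM hR hs u u'
  · intro c c'
    rw [hY s hs c c', e.sum_comp fun τ => S τ c * S τ c']

/-- The entropy of the sites before `M` and the sites after `M`, averaged over the outcomes of
measuring `M`. -/
noncomputable def meanEntropy (Ψ : (Fin L → Fin d) → ℂ) (M R : Finset (Fin L)) : ℝ :=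
  ∑ σ ∈ Finset.univ.filter (fun σ : {x // x ∈ M} → Fin d => 0 < probM Ψ M σ),
    probM Ψ M σ * vnEntropy (rhoR (postState Ψ M σ) R)

theorem meanEntropy_le (z : Fin d) (h1 : NormalizedLine Ψ)
    (h0 : NonNegLine Ψ) (hc : ZeroCorr Ψ) (h : m + 1 + n + p = L)
    (hM : ∀ x, x ∈ M ↔ m + 1 ≤ x.1 ∧ x.1 < m + 1 + n) {R : Finset (Fin L)}
    (hR : ∀ x, x ∈ R ↔ x.1 < m + 1) :
    meanEntropy Ψ M R ≤ 2 * √d * ∑ s ∈ words d n,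
      √(frobSq (segMat (wordAmp z Ψ) (m + 1) p s) ^ 2 -
        gramSq (segMat (wordAmp z Ψ) (m + 1) p s)) ∧
    meanEntropy Ψ M R ≤
      Real.log d - (1 - 1 / d - avgLinEnt (wordAmp z Ψ) (m + 1) n p) / 4 := by
  have hψ := wordState_wordAmp z h1 h0 hc
  have hsum := hψ.sum_frobSq h
  rw [meanEntropy, Finset.sum_filter, sum_block z (by omega) hM]
  constructor
  · rw [Finset.mul_sum]
    refine Finset.sum_le_sum fun s hs => ?_
    rw [probM_block z h0 h hM hs]
    split_ifs with hpos
    · exact (frobSq_mul_vnEntropy_postState_le z h1 h0 hc h hM hR hs hpos).1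
    · positivity
  · have e : Real.log d - (1 - 1 / d - avgLinEnt (wordAmp z Ψ) (m + 1) n p) / 4 =
        ∑ s ∈ words d n, (frobSq (segMat (wordAmp z Ψ) (m + 1) p s) * Real.log d -
          (frobSq (segMat (wordAmp z Ψ) (m + 1) p s) * (1 - 1 / d) -
            linEnt (segMat (wordAmp z Ψ) (m + 1) p s)) / 4) := by
      rw [Finset.sum_sub_distrib, ← Finset.sum_div, Finset.sum_sub_distrib, ← Finset.sum_mul,
        ← Finset.sum_mul, hsum, one_mul, one_mul]
      rfl
    rw [e]
    refine Finset.sum_le_sum fun s hs => ?_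
    rw [probM_block z h0 h hM hs]
    split_ifs with hpos
    · exact (frobSq_mul_vnEntropy_postState_le z h1 h0 hc h hM hR hs hpos).2
    · have hz : frobSq (segMat (wordAmp z Ψ) (m + 1) p s) = 0 :=
        le_antisymm (not_lt.1 hpos) (frobSq_nonneg _)
      simp [linEnt, hz]

end measurement

theorem WordState.avgLinEnt_le_sub {d L : ℕ} {ψ : List (Fin d) → ℝ} (hψ : WordState d L ψ)
    (hd : 2 ≤ d) {m n p : ℕ} (hn : 1 ≤ n) (h : m + 1 + n + p = L) :
    avgLinEnt ψ (m + 1) n p ≤ 1 - 1 / d - 1 / (4 ^ 8 * (324 * (d : ℝ) ^ 4)) := by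
  obtain ⟨k, rfl⟩ : ∃ k, n = 0 + (k + 1) := ⟨n - 1, by omega⟩
  have hs := hψ.avgLinEnt_step (m := m + 1) (n := 0) (k := k) (p := p) (by omega)
  have h1 := hψ.avgLinEnt_base (m := m) (n := 0) (p := k + p + 1) (by omega)
  have h2 := hψ.avgLinEnt_base (m := m + 1 + 0) (n := k) (p := p) (by omega)
  have hd' : (2 : ℝ) ≤ d := by exact_mod_cast hd
  have hd4 : (1 : ℝ) ≤ 324 * (d : ℝ) ^ 4 := by
    have : (1 : ℝ) ≤ (d : ℝ) ^ 4 := one_le_pow₀ (by linarith)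
    linarith
  have hdi : 1 / (d : ℝ) ≤ 1 / 2 := one_div_le_one_div_of_le two_pos hd'
  set e := avgLinEnt ψ (m + 1) (0 + (k + 1)) p
  rcases le_or_gt (1 / 4) e with he | he
  · have h8 : (1 / 4 : ℝ) ^ 8 ≤ e ^ 8 := pow_le_pow_left₀ (by norm_num) he 8
    have h9 : 1 / (4 ^ 8 * (324 * (d : ℝ) ^ 4)) ≤ e ^ 8 / (324 * (d : ℝ) ^ 4) := by
      rw [← div_div]
      exact div_le_div_of_nonneg_right (by simpa using h8) (by linarith)
    linarith
  · have : 1 / (4 ^ 8 * (324 * (d : ℝ) ^ 4)) ≤ 1 / 4 :=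
      one_div_le_one_div_of_le (by norm_num) (by linarith)
    linarith

theorem exists_rate {l δ K : ℝ} (hl : 0 < l) (hδ : 0 < δ) (hK : 0 ≤ K) {N : ℕ} (hN : 0 < N) :
    ∃ c : ℝ, 0 ≤ c ∧ c < 1 ∧ ∀ (n : ℕ) (S : ℝ), S ≤ l → (1 ≤ n → S ≤ l - δ) →
      S ≤ K * (1 / 2) ^ (n / N) → S ≤ c ^ n * l := by
  obtain ⟨q₁, hq₁⟩ := exists_pow_lt_of_lt_one (show 0 < 3 / 4 * l / (K + 1) by positivity)
    (show (2 / 3 : ℝ) < 1 by norm_num)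
  have hN' : (1 : ℝ) ≤ N := by exact_mod_cast hN
  set η := min (1 / (4 * (N : ℝ))) (δ / (l * (N * (q₁ + 1)))) with hη
  have hη0 : 0 < η := lt_min (by positivity) (by positivity)
  have hη1 : N * η ≤ 1 / 4 := by
    have := mul_le_mul_of_nonneg_left (min_le_left (1 / (4 * (N : ℝ))) (δ / (l * (N * (q₁ + 1)))))
      (by linarith : (0 : ℝ) ≤ N)
    refine this.trans (le_of_eq ?_)
    field_simp
  have hη2 : N * (q₁ + 1) * η * l ≤ δ := by
    have := min_le_right (1 / (4 * (N : ℝ))) (δ / (l * (N * (q₁ + 1))))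
    rw [← hη, le_div_iff₀ (by positivity)] at this
    linarith
  have hη3 : η ≤ 1 / 4 := by nlinarith
  have hpow : ∀ n : ℕ, 1 - n * η ≤ (1 - η) ^ n := fun n => by
    have := one_add_mul_le_pow (show -2 ≤ -η by linarith) n
    rw [← sub_eq_add_neg] at this
    linarith
  refine ⟨1 - η, by linarith, by linarith, fun n S h0 h1 h2 => ?_⟩
  rcases Nat.eq_zero_or_pos n with rfl | hn
  · simpa using h0
  rcases lt_or_ge (n / N) q₁ with hq | hq
  · have hnN : n < q₁ * N := (Nat.div_lt_iff_lt_mul hN).1 hq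
    have hnN' : (n : ℝ) ≤ N * (q₁ + 1) := by
      have : (n : ℝ) < q₁ * N := by exact_mod_cast hnN
      nlinarith
    have h3 : n * η * l ≤ δ := le_trans (by gcongr) hη2
    have h4 := mul_le_mul_of_nonneg_right (hpow n) hl.le
    have := h1 hn
    linarith
  · set q := n / N with hqd
    have h3 : (2 / 3 : ℝ) ^ q * (K + 1) ≤ 3 / 4 * l := by
      rw [← le_div_iff₀ (by positivity)]
      exact (pow_le_pow_of_le_one (by norm_num) (by norm_num) hq).trans hq₁.le
    have h4 : K * (1 / 2) ^ q ≤ (3 / 4) ^ (q + 1) * l := by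
      have e : (1 / 2 : ℝ) ^ q = (3 / 4) ^ q * (2 / 3) ^ q := by rw [← mul_pow]; norm_num
      calc K * (1 / 2) ^ q ≤ (K + 1) * (1 / 2) ^ q := by gcongr; linarith
        _ = (3 / 4) ^ q * ((2 / 3) ^ q * (K + 1)) := by rw [e]; ring
        _ ≤ (3 / 4) ^ q * (3 / 4 * l) := by gcongr
        _ = _ := by ring
    have hnN : n ≤ N * (q + 1) := (Nat.lt_mul_div_succ n hN).le
    have h5 : (3 / 4 : ℝ) ^ (q + 1) ≤ (1 - η) ^ n := by
      refine le_trans (pow_le_pow_left₀ (by norm_num) (?_ : (3 / 4 : ℝ) ≤ (1 - η) ^ N) _) ?_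
      · have := hpow N
        linarith
      · rw [← pow_mul]
        exact pow_le_pow_of_le_one (by linarith) (by linarith) hnN
    exact (h2.trans h4).trans (mul_le_mul_of_nonneg_right h5 hl.le)

theorem exists_meanEntropy_le (d : ℕ) : ∃ c : ℝ, 0 ≤ c ∧ c < 1 ∧
    ∀ {L : ℕ} {Ψ : (Fin L → Fin d) → ℂ}, NormalizedLine Ψ → NonNegLine Ψ → ZeroCorr Ψ →
      ∀ {m n p : ℕ} {M R : Finset (Fin L)}, m + 1 + n + p = L →
        (∀ x, x ∈ M ↔ m + 1 ≤ x.1 ∧ x.1 < m + 1 + n) → (∀ x, x ∈ R ↔ x.1 < m + 1) →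
          meanEntropy Ψ M R ≤ c ^ n * Real.log d := by
  rcases Nat.lt_trichotomy d 1 with hd | rfl | hd
  · obtain rfl : d = 0 := by omega
    refine ⟨0, le_rfl, one_pos, ?_⟩
    intro L Ψ h1 _ _ m n p M R h
    have : IsEmpty (Fin L → Fin 0) := ⟨fun f => (f ⟨0, by omega⟩).elim0⟩
    simp [NormalizedLine] at h1
  · refine ⟨0, le_rfl, one_pos, ?_⟩
    intro L Ψ h1 h0 hc m n p M R h hM hR
    have h2 := (meanEntropy_le 0 h1 h0 hc h hM hR).2
    have h3 := (wordState_wordAmp 0 h1 h0 hc).avgLinEnt_base h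
    simp only [Nat.cast_one, Real.log_one, mul_zero, div_one] at h2 h3 ⊢
    linarith
  · have hd1 : 1 ≤ d := hd.le
    have hd' : (1 : ℝ) < d := by exact_mod_cast hd
    have hd0 : (0 : ℝ) < d := by linarith
    obtain ⟨n₀, hn₀⟩ := exists_avgLinEnt_le hd1 (show (0 : ℝ) < 1 / (4 * d) by positivity)
    obtain ⟨c, hc0, hc1, hc⟩ := exists_rate (l := Real.log d)
      (δ := 1 / (4 ^ 8 * (324 * (d : ℝ) ^ 4)) / 4) (K := 2 * √d * d) (N := n₀ + 1)
      (Real.log_pos hd') (by positivity) (by positivity) (Nat.succ_pos _)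
    refine ⟨c, hc0, hc1, ?_⟩
    intro L Ψ h1 h0 hz m n p M R h hM hR
    have hψ := wordState_wordAmp ⟨0, hd1⟩ h1 h0 hz
    obtain ⟨hS1, hS2⟩ := meanEntropy_le ⟨0, hd1⟩ h1 h0 hz h hM hR
    refine hc n _ ?_ ?_ ?_
    · have := hψ.avgLinEnt_base h
      linarith
    · intro hn
      have := hψ.avgLinEnt_le_sub hd hn h
      linarith
    · have h3 := hψ.sum_sqrt_le (fun h => hn₀ hψ h) h
      rw [mul_assoc _ (d : ℝ)]
      exact hS1.trans (mul_le_mul_of_nonneg_left h3 (by positivity))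

theorem stmt11 (d : ℕ) :
    ∃ c : ℝ, 0 ≤ c ∧ c < 1 ∧
      ∀ (L : ℕ) (Ψ : (Fin L → Fin d) → ℂ),
        NormalizedLine Ψ → NonNegLine Ψ → ZeroCorr Ψ →
        ∀ i j : Fin L, i < j →
          (∑ σ ∈ Finset.univ.filter
              (fun σ : {x : Fin L // x ∈ Finset.univ.filter fun k => i < k ∧ k < j} → Fin d =>
                0 < probM Ψ (Finset.univ.filter fun k => i < k ∧ k < j) σ),
            probM Ψ (Finset.univ.filter fun k => i < k ∧ k < j) σ *
              vnEntropy (rhoR (postState Ψ (Finset.univ.filter fun k => i < k ∧ k < j) σ)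
                (Finset.univ.filter fun k => k ≤ i))) ≤
          c ^ ((j : ℕ) - (i : ℕ) - 1) * Real.log d := by
  obtain ⟨c, hc0, hc1, hc⟩ := exists_meanEntropy_le d
  refine ⟨c, hc0, hc1, fun L Ψ h1 h0 hz i j hij => ?_⟩
  rw [Fin.lt_def] at hij
  refine hc h1 h0 hz (m := i) (n := (j : ℕ) - i - 1) (p := L - j) (by omega) (fun x => ?_)
    fun x => ?_
  · simp only [Finset.mem_filter, Finset.mem_univ, true_and, Fin.lt_def]
    omega
  · simp only [Finset.mem_filter, Finset.mem_univ, true_and, Fin.le_def]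
    omega
end

section
/- Let Q_0 and Q_1 be orthogonal projections on a finite-dimensional complex inner product space. For a positive semidefinite operator O, let Δ(O) denote its smallest nonzero eigenvalue (when O ≠ 0). Then, provided (1−Q_1)Q_0(1−Q_1) ≠ 0, the smallest nonzero eigenvalue of Q_0 + Q_1 satisfies Δ(Q_0 + Q_1) ≥ (1/2) · Δ(Q_1 + (1−Q_1)Q_0(1−Q_1)). -/
/-- The smallest nonzero eigenvalue of a Hermitian matrix (junk value `0` otherwise). -/
noncomputable def smallestNonzeroEig {n : ℕ} (O : Matrix (Fin n) (Fin n) ℂ) : ℝ :=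
  if h : O.IsHermitian then sInf {x : ℝ | (∃ a, h.eigenvalues a = x) ∧ x ≠ 0} else 0

open Matrix in
/-- A nonzero real eigenvalue of a Hermitian matrix bounds its smallest nonzero eigenvalue. -/
theorem smallestNonzeroEig_le_of_mulVec_eq {n : ℕ} {M : Matrix (Fin n) (Fin n) ℂ}
    (hM : M.IsHermitian) {μ : ℝ} (hμ : μ ≠ 0) {w : Fin n → ℂ} (hw : w ≠ 0)
    (h : M *ᵥ w = (μ : ℂ) • w) : smallestNonzeroEig M ≤ μ := by
  have hspec : μ ∈ spectrum ℝ M := by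
    apply spectrum.of_algebraMap_mem ℂ
    rw [← Matrix.spectrum_toLin']
    exact (Module.End.hasEigenvalue_of_hasEigenvector
      (Module.End.hasEigenvector_iff.2
        ⟨Module.End.mem_eigenspace_iff.2 (by simpa using h), hw⟩)).mem_spectrum
  rw [hM.spectrum_real_eq_range_eigenvalues] at hspec
  rw [smallestNonzeroEig, dif_pos hM]
  exact csInf_le ((Set.finite_range hM.eigenvalues).subset fun x hx => hx.1).bddBelow
    ⟨hspec, hμ⟩

open Matrix in
/-- A lower bound for the nonzero eigenvalues of a nonzero Hermitian matrix bounds its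
smallest nonzero eigenvalue from below. -/
theorem le_smallestNonzeroEig {n : ℕ} {M : Matrix (Fin n) (Fin n) ℂ}
    (hM : M.IsHermitian) (hne : M ≠ 0) {c : ℝ}
    (h : ∀ (l : ℝ) (v : Fin n → ℂ), l ≠ 0 → v ≠ 0 → M *ᵥ v = (l : ℂ) • v → c ≤ l) :
    c ≤ smallestNonzeroEig M := by
  rw [smallestNonzeroEig, dif_pos hM]
  refine le_csInf ?_ ?_
  · obtain ⟨a, ha⟩ := Function.ne_iff.1 (mt hM.eigenvalues_eq_zero_iff.1 hne)
    exact ⟨_, ⟨a, rfl⟩, ha⟩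
  · rintro _ ⟨⟨a, rfl⟩, ha⟩
    refine h _ (hM.eigenvectorBasis a) ha ?_ ?_
    · intro h0
      exact hM.eigenvectorBasis.orthonormal.ne_zero a (by ext i; exact congrFun h0 i)
    · rw [hM.mulVec_eigenvectorBasis a]
      ext i
      simp

open Matrix in
/-- An eigenvector `v` of the sum of two idempotents with eigenvalue `l` yields the vector
`(1 - Q₁) v`, which satisfies the eigenvector equation of `Q₁ + (1 - Q₁) Q₀ (1 - Q₁)` with
eigenvalue `(2 - l) l`. -/
theorem compression_mulVec_of_add_mulVec {n : ℕ} {Q0 Q1 : Matrix (Fin n) (Fin n) ℂ}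
    (h0i : Q0 * Q0 = Q0) (h1i : Q1 * Q1 = Q1) {l : ℂ} {v : Fin n → ℂ}
    (hv : (Q0 + Q1) *ᵥ v = l • v) :
    Q1 *ᵥ (v - Q1 *ᵥ v) = 0 ∧ Q0 *ᵥ (v - Q1 *ᵥ v) = (2 - l) • (Q0 *ᵥ v) ∧
      (Q1 + (1 - Q1) * Q0 * (1 - Q1)) *ᵥ (v - Q1 *ᵥ v) =
        ((2 - l) * l) • (v - Q1 *ᵥ v) := by
  rw [add_mulVec] at hv
  have h1w : Q1 *ᵥ (v - Q1 *ᵥ v) = 0 := by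
    rw [mulVec_sub, mulVec_mulVec, h1i, sub_self]
  have h1a : Q1 *ᵥ (Q0 *ᵥ v) = l • (Q1 *ᵥ v) - Q1 *ᵥ v := by
    rw [← mulVec_smul, ← hv, mulVec_add, mulVec_mulVec v Q1 Q1, h1i, add_sub_cancel_right]
  have h0b : Q0 *ᵥ (Q1 *ᵥ v) = l • (Q0 *ᵥ v) - Q0 *ᵥ v := by
    rw [← mulVec_smul, ← hv, mulVec_add, mulVec_mulVec v Q0 Q0, h0i, add_sub_cancel_left]
  have h0w : Q0 *ᵥ (v - Q1 *ᵥ v) = (2 - l) • (Q0 *ᵥ v) := by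
    rw [mulVec_sub, h0b]
    module
  refine ⟨h1w, h0w, ?_⟩
  have hPw : (1 - Q1) *ᵥ (v - Q1 *ᵥ v) = v - Q1 *ᵥ v := by
    rw [sub_mulVec, one_mulVec, h1w, sub_zero]
  rw [add_mulVec, h1w, zero_add, ← mulVec_mulVec, hPw, ← mulVec_mulVec, h0w, mulVec_smul,
    sub_mulVec, one_mulVec, h1a, mul_smul, smul_sub l, ← hv]
  module

open Matrix ComplexOrder in
/-- For orthogonal projections `Q₀, Q₁` (on a finite-dimensional complex inner product
space, realized as Hermitian idempotent matrices), provided `(1-Q₁)Q₀(1-Q₁) ≠ 0`,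
`Δ(Q₀ + Q₁) ≥ (1/2)·Δ(Q₁ + (1-Q₁)Q₀(1-Q₁))`. -/
theorem stmt12 {n : ℕ} (Q0 Q1 : Matrix (Fin n) (Fin n) ℂ)
    (h0 : Q0.IsHermitian) (h1 : Q1.IsHermitian)
    (h0i : Q0 * Q0 = Q0) (h1i : Q1 * Q1 = Q1)
    (hne : (1 - Q1) * Q0 * (1 - Q1) ≠ 0) :
    (1 / 2) * smallestNonzeroEig (Q1 + (1 - Q1) * Q0 * (1 - Q1)) ≤
      smallestNonzeroEig (Q0 + Q1) := by
  have hM : (Q1 + (1 - Q1) * Q0 * (1 - Q1)).IsHermitian := by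
    simp [IsHermitian, conjTranspose_mul, h0.eq, h1.eq, mul_assoc]
  refine le_smallestNonzeroEig (h0.add h1) ?_ ?_
  · intro hsum
    have hQ : Q0 = -Q1 := eq_neg_of_add_eq_zero_left hsum
    have hQ' : Q0 = Q1 := by rw [← h0i, hQ, neg_mul_neg, h1i]
    exact hne (by rw [hQ', mul_assoc, mul_sub, mul_one, h1i, sub_self, mul_zero])
  · intro l v hl hv0 hv
    obtain ⟨h1w, h0w, hMw⟩ := compression_mulVec_of_add_mulVec h0i h1i hv
    by_cases hw : v - Q1 *ᵥ v = 0
    · have hb : Q1 *ᵥ v = v := (sub_eq_zero.1 hw).symm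
      have hMv : (Q1 + (1 - Q1) * Q0 * (1 - Q1)) *ᵥ v = ((1 : ℝ) : ℂ) • v := by
        rw [add_mulVec, ← mulVec_mulVec, sub_mulVec 1 Q1 v, one_mulVec, hb, sub_self]
        simp
      have hle := smallestNonzeroEig_le_of_mulVec_eq hM one_ne_zero hv0 hMv
      have ha : Q0 *ᵥ v = ((l : ℂ) - 1) • v := by
        rw [add_mulVec, hb] at hv
        rw [eq_sub_of_add_eq hv]
        module
      have hsq : ((2 - (l : ℂ)) * (l - 1)) • v = 0 := by
        rw [mul_smul, ← ha, ← h0w, hw, mulVec_zero]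
      have hl12 : (2 - l) * (l - 1) = 0 := by
        exact_mod_cast (smul_eq_zero.1 hsq).resolve_right hv0
      rcases mul_eq_zero.1 hl12 with h | h <;> linarith
    · have hl2 : 2 - l ≠ 0 := by
        intro hl2
        have hl2c : (2 : ℂ) - l = 0 := by exact_mod_cast hl2
        rw [hl2c, zero_smul] at h0w
        have orth : ∀ Q : Matrix (Fin n) (Fin n) ℂ, Q.IsHermitian →
            Q *ᵥ (v - Q1 *ᵥ v) = 0 → star (v - Q1 *ᵥ v) ⬝ᵥ (Q *ᵥ v) = 0 := by
          intro Q hQ hz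
          rw [dotProduct_mulVec, ← hQ.eq, ← star_mulVec, hz, star_zero, zero_dotProduct]
        have hwv : star (v - Q1 *ᵥ v) ⬝ᵥ v = 0 := by
          have := congrArg (star (v - Q1 *ᵥ v) ⬝ᵥ ·) hv
          simp only [add_mulVec, dotProduct_add, orth Q0 h0 h0w, orth Q1 h1 h1w,
            dotProduct_smul, add_zero, smul_eq_mul] at this
          exact (mul_eq_zero.1 this.symm).resolve_left (by exact_mod_cast hl)
        refine hw (dotProduct_star_self_eq_zero.1 ?_)
        rw [dotProduct_sub, hwv, orth Q1 h1 h1w, sub_zero]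
      have hle := smallestNonzeroEig_le_of_mulVec_eq hM (mul_ne_zero hl2 hl) hw
        (by push_cast; exact hMw)
      nlinarith [sq_nonneg l]
end
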